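/- arXiv:2307.06021 — 4 statements merged into one kernel-verified Lean document; each statement's English description precedes it below -/
import Mathlib

section
/- For ℓ ≥ 6, the S-module D(A(C_ℓ^C)) of the ℓ-antihole admits a minimal graded free resolution 0 → S(−ℓ+1) → S(−ℓ+2)^{ℓ−1} → (⊕_{i=0}^{ℓ−4} S(−i)) ⊕ S(−ℓ+3)^{ℓ+1} → D(A(C_ℓ^C)) → 0; in particular there is an exact sequence of S-modules 0 → S → S^{ℓ−1} → S^{2ℓ−2} → D(A(C_ℓ^C)) → 0 in which all the matrices of the maps between free modules have entries of positive degree, and pd(D(A(C_ℓ^C))) = 2. -/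
open MvPolynomial CategoryTheory

/-- The polynomial ring `S = ℚ[x_1, …, x_ℓ]` (variables indexed by `Fin ℓ`). -/
abbrev Spoly (ℓ : ℕ) : Type := MvPolynomial (Fin ℓ) ℚ

/-- The module `D(A(G))` of logarithmic derivations of the graphic arrangement of a
graph `G` on the vertex set `{1, …, ℓ}`: all `θ ∈ Der_ℚ(S)` such that `(x_i - x_j)`
divides `θ(x_i) - θ(x_j)` for every edge `{i, j}` of `G`. -/
noncomputable def logDer (ℓ : ℕ) (G : SimpleGraph (Fin ℓ)) :
    Submodule (Spoly ℓ) (Derivation ℚ (Spoly ℓ) (Spoly ℓ)) where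
  carrier := {θ | ∀ i j : Fin ℓ, G.Adj i j → (X i - X j) ∣ θ (X i) - θ (X j)}
  add_mem' := by
    intro a b ha hb i j h
    have : (a + b) (X i) - (a + b) (X j)
        = (a (X i) - a (X j)) + (b (X i) - b (X j)) := by
      simp only [Derivation.add_apply]; ring
    rw [this]
    exact dvd_add (ha i j h) (hb i j h)
  zero_mem' := by intro i j h; simp
  smul_mem' := by
    intro c θ hθ i j h
    have : (c • θ) (X i) - (c • θ) (X j) = c * (θ (X i) - θ (X j)) := by
      simp only [Derivation.smul_apply, smul_eq_mul]; ring
    rw [this]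
    exact (hθ i j h).mul_left c

/-- `pdLE M n` : `M` admits a projective resolution vanishing in homological
degrees above `n`, i.e. the projective dimension of `M` is at most `n`. -/
def pdLE {R : Type} [CommRing R] (M : ModuleCat R) (n : ℕ) : Prop :=
  ∃ P : ProjectiveResolution M, ∀ i : ℕ, n < i → Limits.IsZero (P.complex.X i)

/-- The projective dimension of a module, as an element of `ℕ∞`
(infimum of the lengths of projective resolutions; `⊤` if there is none of finite length). -/
noncomputable def pd {R : Type} [CommRing R] (M : ModuleCat R) : ℕ∞ :=
  sInf {n : ℕ∞ | ∃ k : ℕ, (k : ℕ∞) = n ∧ pdLE M k}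

/-- The generator degrees of the free module `(⊕_{i=0}^{ℓ-4} S(-i)) ⊕ S(-ℓ+3)^{ℓ+1}`. -/
def gendeg (ℓ : ℕ) (i : Fin (2 * ℓ - 2)) : ℕ :=
  if (i : ℕ) ≤ ℓ - 4 then (i : ℕ) else ℓ - 3

namespace MvPolynomial

variable {R σ : Type*} [CommRing R]

theorem sub_rename_mem (I : Ideal (MvPolynomial σ R)) (τ : σ → σ)
    (h : ∀ i, X i - X (τ i) ∈ I) (f : MvPolynomial σ R) : f - rename τ f ∈ I := by
  rw [← Ideal.Quotient.eq]
  have : Ideal.Quotient.mkₐ R I = (Ideal.Quotient.mkₐ R I).comp (rename τ) := by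
    ext i
    simpa using Ideal.Quotient.eq.mpr (h i)
  exact DFunLike.congr_fun this f

theorem X_sub_X_dvd_rename {i j : σ} {f g : MvPolynomial σ R} (h : X i - X j ∣ f - g)
    (τ : σ → σ) : X (τ i) - X (τ j) ∣ rename τ f - rename τ g := by
  simpa only [map_sub, rename_X] using map_dvd (rename τ) h

theorem X_sub_X_dvd_iff [DecidableEq σ] (i j : σ) (f : MvPolynomial σ R) :
    X i - X j ∣ f ↔ rename (Function.update id i j) f = 0 := by
  constructor
  · rintro ⟨g, rfl⟩
    by_cases h : j = i <;> simp [h]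
  · intro h
    have := sub_rename_mem (Ideal.span {X i - X j}) (Function.update id i j) (fun k => by
      by_cases hk : k = i
      · subst hk
        simp
      · simp [hk]) f
    rwa [h, sub_zero, Ideal.mem_span_singleton] at this

theorem X_sub_X_ne_zero [Nontrivial R] {i j : σ} (h : i ≠ j) :
    (X i - X j : MvPolynomial σ R) ≠ 0 :=
  sub_ne_zero.mpr fun h' => h (X_injective h')

theorem prime_X_sub_X [IsDomain R] {i j : σ} (h : i ≠ j) :
    Prime (X i - X j : MvPolynomial σ R) := by
  classical
  refine ⟨X_sub_X_ne_zero h, fun hu => ?_, fun a b hab => ?_⟩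
  · have := (X_sub_X_dvd_iff i j (1 : MvPolynomial σ R)).mp hu.dvd
    simp at this
  · simpa [X_sub_X_dvd_iff] using hab

theorem isRelPrime_X_sub_X [IsDomain R] {i j k l : σ} (hij : i ≠ j) (hki : k ≠ i) (hkl : k ≠ l)
    (h : k ≠ j ∨ l ≠ i) : IsRelPrime (X i - X j : MvPolynomial σ R) (X k - X l) := by
  classical
  refine ((prime_X_sub_X hij).irreducible.isRelPrime_iff_not_dvd).mpr fun hd => ?_
  rw [X_sub_X_dvd_iff, map_sub, rename_X, rename_X, Function.update_of_ne hki, sub_eq_zero] at hd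
  have := X_injective hd
  by_cases hli : l = i
  · subst hli
    simp_all
  · simp_all

theorem prod_X_sub_X_dvd [IsDomain R] [UniqueFactorizationMonoid R] {s : Finset σ} {v : σ}
    (hv : v ∉ s) {f : MvPolynomial σ R} (h : ∀ j ∈ s, X v - X j ∣ f) :
    ∏ j ∈ s, (X v - X j) ∣ f := by
  refine Finset.prod_dvd_of_isRelPrime (fun i hi j hj hij => ?_) h
  rw [Function.onFun, ← neg_sub (X i) (X v : MvPolynomial σ R),
    ← neg_sub (X j) (X v : MvPolynomial σ R)]
  simp only [IsRelPrime.neg_neg_iff]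
  refine isRelPrime_X_sub_X ?_ (Ne.symm hij) ?_ (.inr ?_) <;> rintro rfl <;> contradiction

theorem prod_X_sub_X_ne_zero [IsDomain R] {s : Finset σ} {v : σ} (hv : v ∉ s) :
    ∏ j ∈ s, (X v - X j : MvPolynomial σ R) ≠ 0 :=
  Finset.prod_ne_zero_iff.mpr fun _ hj => X_sub_X_ne_zero fun h => hv (h ▸ hj)

theorem rename_prod_X_sub_X {s : Finset σ} {v : σ} {τ : σ → σ} (hs : ∀ j ∈ s, τ j = j) :
    rename τ (∏ j ∈ s, (X v - X j : MvPolynomial σ R)) = ∏ j ∈ s, (X (τ v) - X j) := by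
  rw [map_prod]
  exact Finset.prod_congr rfl fun j hj => by simp [hs j hj]

end MvPolynomial

section Antihole

variable {n : ℕ}

/-- The vertices that are joined to `v` in the complement of the cycle. -/
def coNbrs (v : Fin (n + 2)) : Finset (Fin (n + 2)) :=
  Finset.univ.filter fun j => v ≠ j ∧ v + 1 ≠ j ∧ j + 1 ≠ v

theorem mem_coNbrs {v j : Fin (n + 2)} : j ∈ coNbrs v ↔ v ≠ j ∧ v + 1 ≠ j ∧ j + 1 ≠ v := by
  simp [coNbrs]

theorem mem_coNbrs_comm {v j : Fin (n + 2)} : j ∈ coNbrs v ↔ v ∈ coNbrs j := by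
  simp only [mem_coNbrs]
  tauto

theorem mem_coNbrs_iff_val {v j : Fin (n + 2)} : j ∈ coNbrs v ↔
    v.val ≠ j.val ∧ v.val + 1 ≠ j.val ∧ j.val + 1 ≠ v.val ∧
      ¬ (v.val = n + 1 ∧ j.val = 0) ∧ ¬ (j.val = n + 1 ∧ v.val = 0) := by
  simp only [mem_coNbrs, ne_eq, Fin.ext_iff, Fin.val_add_one, Fin.val_last]
  have := v.isLt
  have := j.isLt
  split_ifs <;> omega

theorem notMem_coNbrs_self (v : Fin (n + 2)) : v ∉ coNbrs v := by
  simp [mem_coNbrs]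

theorem compl_cycleGraph_adj {v j : Fin (n + 2)} :
    (SimpleGraph.cycleGraph (n + 2))ᶜ.Adj v j ↔ j ∈ coNbrs v := by
  rw [SimpleGraph.compl_adj, SimpleGraph.cycleGraph_adj, mem_coNbrs, sub_eq_iff_eq_add,
    sub_eq_iff_eq_add, add_comm 1 j, add_comm 1 v]
  tauto

/-- The coefficient of the logarithmic derivation of the antihole supported at `v`. -/
noncomputable def coNbrProd (v : Fin (n + 2)) : Spoly (n + 2) := ∏ j ∈ coNbrs v, (X v - X j)

theorem coNbrProd_ne_zero (v : Fin (n + 2)) : coNbrProd v ≠ 0 :=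
  prod_X_sub_X_ne_zero (notMem_coNbrs_self v)

/-- The condition on the values `p v = θ (X v)` for `θ` to be logarithmic along the antihole. -/
def IsSpline (p : Fin (n + 2) → Spoly (n + 2)) : Prop :=
  ∀ v, ∀ j ∈ coNbrs v, X v - X j ∣ p v - p j

theorem IsSpline.congr {p p' : Fin (n + 2) → Spoly (n + 2)} (hp : IsSpline p)
    (h : ∀ v, coNbrProd v ∣ p v - p' v) : IsSpline p' := by
  intro v j hj
  have h1 : X v - X j ∣ p v - p' v :=
    (Finset.dvd_prod_of_mem (fun j => X v - X j) hj).trans (h v)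
  have h2 : X v - X j ∣ p j - p' j := by
    rw [← neg_sub (X j) (X v : Spoly (n + 2)), neg_dvd]
    exact (Finset.dvd_prod_of_mem (fun i => X j - X i) (mem_coNbrs_comm.mp hj)).trans (h j)
  have := dvd_add (dvd_sub (hp v j hj) h1) h2
  rwa [show p v - p j - (p v - p' v) + (p j - p' j) = p' v - p' j by ring] at this

theorem IsSpline.rename_eq {p : Fin (n + 2) → Spoly (n + 2)} (hp : IsSpline p) {v j : Fin (n + 2)}
    (hj : j ∈ coNbrs v) {τ : Fin (n + 2) → Fin (n + 2)} (hτ : τ v = τ j) :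
    rename τ (p v) = rename τ (p j) := by
  obtain ⟨c, hc⟩ := hp v j hj
  rw [← sub_eq_zero, ← map_sub, hc]
  simp [hτ]

theorem IsSpline.exists_congr_two (hn : 3 ≤ n) {p : Fin (n + 2) → Spoly (n + 2)}
    (hp : IsSpline p) : ∃ p' : Fin (n + 2) → Spoly (n + 2),
      (∀ v, coNbrProd v ∣ p v - p' v) ∧ X 1 - X 0 ∣ p' 0 - p' 1 := by
  let z : Fin (n + 2) := Fin.last (n + 1)
  let t : Fin (n + 2) := ⟨2, by omega⟩
  have h1 : (1 : Fin (n + 2)).val = 1 := rfl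
  have h0 : (0 : Fin (n + 2)).val = 0 := rfl
  have hz : z.val = n + 1 := rfl
  have ht : t.val = 2 := rfl
  have h01 : (0 : Fin (n + 2)) ≠ 1 := by simp
  let s : Finset (Fin (n + 2)) := {0, 1, t, z}ᶜ
  have hs : ∀ j, j ∈ s ↔ j.val ≠ 0 ∧ j.val ≠ 1 ∧ j.val ≠ 2 ∧ j.val ≠ n + 1 := by
    intro j
    simp [s, Fin.ext_iff, hz, ht, -Fin.val_eq_zero_iff]
  have hs0 : coNbrs 0 = insert t s := by
    ext j
    rw [mem_coNbrs_iff_val, Finset.mem_insert, hs, Fin.ext_iff, h0, ht]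
    omega
  have hs1 : coNbrs 1 = insert z s := by
    ext j
    rw [mem_coNbrs_iff_val, Finset.mem_insert, hs, Fin.ext_iff, h1, hz]
    have := j.isLt
    omega
  let σ : Fin (n + 2) → Fin (n + 2) := Function.update id 1 0
  let τ : Fin (n + 2) → Fin (n + 2) := fun j => if j ∈ s then j else 0
  have hσs : ∀ j ∈ s, σ j = j := by
    intro j hj
    have : j ≠ 1 := fun h => by simp [hs, h] at hj
    simp [σ, this]
  have hτs : ∀ j ∈ s, τ j = j := fun j hj => if_pos hj
  have hτ0 : τ 0 = 0 := if_neg (by simp [hs])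
  have hτ1 : τ 1 = 0 := if_neg (by simp [hs])
  have hτt : τ t = 0 := if_neg (by simp [hs, ht])
  have hτz : τ z = 0 := if_neg (by simp [hs, hz])
  have hσ0 : σ 0 = 0 := by simp [σ]
  have hσ1 : σ 1 = 0 := by simp [σ]
  have hσt : σ t = t := Function.update_of_ne (by simp [Fin.ext_iff, ht]) _ _
  have hσz : σ z = z := Function.update_of_ne (by simp [Fin.ext_iff, hz]; omega) _ _
  have hσσ : σ ∘ σ = σ := by
    ext j
    by_cases h : j = 1 <;> simp [σ, h]
  have hτσ : τ ∘ σ = τ := by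
    ext j
    by_cases h : j = 1
    · simp [h, hσ1, hτ1, hτ0]
    · simp [σ, h]
  let B : Spoly (n + 2) := ∏ j ∈ s, (X 0 - X j)
  have hB0 : B ≠ 0 := prod_X_sub_X_ne_zero (by simp [hs])
  have hσB : rename σ B = B := by
    simp only [B, rename_prod_X_sub_X hσs, hσ0]
  have hτB : rename τ B = B := by
    simp only [B, rename_prod_X_sub_X hτs, hτ0]
  have hdvd : B ∣ rename σ (p 0 - p 1) := by
    refine prod_X_sub_X_dvd (by simp [hs]) fun j hj => ?_
    have e0 := X_sub_X_dvd_rename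
      (hp 0 j (by rw [hs0]; exact Finset.mem_insert_of_mem hj)) σ
    have e1 := X_sub_X_dvd_rename
      (hp 1 j (by rw [hs1]; exact Finset.mem_insert_of_mem hj)) σ
    rw [hσs j hj, hσ0] at e0
    rw [hσs j hj, hσ1] at e1
    have e := dvd_sub e0 e1
    rwa [sub_sub_sub_cancel_right, ← map_sub] at e
  obtain ⟨q, hq⟩ := hdvd
  have hτq : rename τ q = 0 := by
    have e : rename τ (rename σ (p 0 - p 1)) = 0 := by
      rw [rename_rename, hτσ, map_sub,
        hp.rename_eq (v := 0) (j := t) (by rw [mem_coNbrs_iff_val]; omega) (by rw [hτ0, hτt]),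
        hp.rename_eq (v := t) (j := z) (by rw [mem_coNbrs_iff_val]; omega) (by rw [hτz, hτt]),
        hp.rename_eq (v := z) (j := 1) (by rw [mem_coNbrs_iff_val]; omega) (by rw [hτz, hτ1]),
        sub_self]
    rw [hq, map_mul, hτB] at e
    exact (mul_eq_zero.mp e).resolve_left hB0
  have hqmem : q ∈ Ideal.span {X 1 - X 0, X t - X 0, X z - X 0} := by
    rw [← sub_zero q, ← hτq]
    refine sub_rename_mem _ τ (fun j => ?_) q
    by_cases hj : j ∈ s
    · simp [hτs j hj]
    · have e : τ j = 0 := if_neg hj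
      rw [e]
      simp only [s, Finset.mem_compl, not_not, Finset.mem_insert, Finset.mem_singleton] at hj
      rcases hj with rfl | rfl | rfl | rfl
      · simp
      all_goals exact Ideal.subset_span (by simp)
  obtain ⟨u, v, w, rfl⟩ := Submodule.mem_span_triple.mp hqmem
  refine ⟨Function.update (Function.update p 0 (p 0 + v * coNbrProd 0)) 1 (p 1 - w * coNbrProd 1),
    fun k => ?_, ?_⟩
  · by_cases hk1 : k = 1
    · subst hk1
      simp
    by_cases hk0 : k = 0
    · subst hk0
      simp [h01]
    · simp [hk0, hk1]
  · rw [X_sub_X_dvd_iff]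
    simp only [Function.update_self, ne_eq, h01, not_false_eq_true, Function.update_of_ne]
    change rename σ _ = 0
    have e := congrArg (rename σ) hq
    rw [rename_rename, hσσ, map_mul, hσB] at e
    have e0 : rename σ (coNbrProd 0) = (X 0 - X t) * B := by
      rw [coNbrProd, hs0, Finset.prod_insert (by simp [hs, ht]), map_mul, map_sub, rename_X,
        rename_X, hσ0, hσt, hσB]
    have e1 : rename σ (coNbrProd 1) = (X 0 - X z) * B := by
      rw [coNbrProd, hs1, Finset.prod_insert (by simp [hs, hz]), map_mul, map_sub, rename_X,
        rename_X, hσ1, hσz, rename_prod_X_sub_X hσs, hσ1]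
    rw [show p 0 + v * coNbrProd 0 - (p 1 - w * coNbrProd 1) =
      (p 0 - p 1) + v * coNbrProd 0 + w * coNbrProd 1 by ring, map_add, map_add, e, map_mul,
      map_mul, e0, e1]
    simp only [smul_eq_mul, map_add, map_mul, map_sub, rename_X, hσ0, hσ1, hσt, hσz]
    ring

theorem IsSpline.exists_congr_of_lt (hn : 3 ≤ n) {p : Fin (n + 2) → Spoly (n + 2)}
    (hp : IsSpline p) (m : ℕ) (hm : 2 ≤ m) (hmn : m ≤ n) :
    ∃ p' : Fin (n + 2) → Spoly (n + 2), (∀ v, coNbrProd v ∣ p v - p' v) ∧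
      ∀ i j : Fin (n + 2), i.val < m → j.val < i.val → X i - X j ∣ p' i - p' j := by
  induction m, hm using Nat.le_induction with
  | base =>
    obtain ⟨p', h, h'⟩ := hp.exists_congr_two hn
    refine ⟨p', h, fun i j hi hj => ?_⟩
    obtain rfl : i = 1 := by
      rw [Fin.ext_iff]
      change i.val = 1
      omega
    obtain rfl : j = 0 := by
      rw [Fin.ext_iff]
      change j.val = 0
      have : (1 : Fin (n + 2)).val = 1 := rfl
      omega
    rwa [← neg_sub (p' 1), dvd_neg] at h'
  | succ m hm ih =>
    obtain ⟨p', h, h'⟩ := ih (by omega)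
    have hp' := hp.congr h
    let a : Fin (n + 2) := ⟨m - 1, by omega⟩
    let b : Fin (n + 2) := ⟨m, by omega⟩
    have ha : a.val = m - 1 := rfl
    have hb : b.val = m := rfl
    have hab : b ≠ a := by
      rw [ne_eq, Fin.ext_iff]
      omega
    let σ : Fin (n + 2) → Fin (n + 2) := Function.update id b a
    have hσ : ∀ j, j ≠ b → σ j = j := fun j hj => Function.update_of_ne hj _ _
    have hσb : σ b = a := Function.update_self ..
    have hjb : ∀ j ∈ coNbrs b, j ≠ b := fun j hj e => notMem_coNbrs_self b (e ▸ hj)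
    have hσB : rename σ (coNbrProd b) = ∏ j ∈ coNbrs b, (X a - X j) := by
      rw [coNbrProd, rename_prod_X_sub_X fun j hj => hσ j (hjb j hj), hσb]
    have hdvd : ∏ j ∈ coNbrs b, (X a - X j) ∣ rename σ (p' b - p' a) := by
      refine prod_X_sub_X_dvd (by rw [mem_coNbrs_iff_val]; omega) fun j hj => ?_
      have e1 := X_sub_X_dvd_rename (hp' b j hj) σ
      have e0 : X a - X j ∣ p' a - p' j := by
        by_cases hja : j.val < a.val
        · exact h' a j (by omega) hja
        · refine hp' a j ?_
          rw [mem_coNbrs_iff_val] at hj ⊢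
          have := j.isLt
          omega
      replace e0 := X_sub_X_dvd_rename e0 σ
      rw [hσ j (hjb j hj), hσ a hab.symm] at e0
      rw [hσ j (hjb j hj), hσb] at e1
      have e := dvd_sub e1 e0
      rwa [sub_sub_sub_cancel_right, ← map_sub] at e
    obtain ⟨q, hq⟩ := hdvd
    have hp'' : X b - X a ∣ p' b - q * coNbrProd b - p' a := by
      have e := congrArg (rename σ) hq
      have hσσ : σ ∘ σ = σ := by
        ext j
        by_cases h : j = b
        · simp [h, hσb, hσ a hab.symm]
        · simp [hσ j h]
      rw [X_sub_X_dvd_iff]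
      change rename σ _ = 0
      rw [rename_rename, hσσ, map_mul, rename_prod_X_sub_X (fun j hj => hσ j (hjb j hj)),
        hσ a hab.symm] at e
      rw [show p' b - q * coNbrProd b - p' a = p' b - p' a - q * coNbrProd b by ring, map_sub,
        e, map_mul, hσB]
      ring
    have hcongr : ∀ v, coNbrProd v ∣ p v - Function.update p' b (p' b - q * coNbrProd b) v := by
      intro v
      by_cases hv : v = b
      · subst hv
        rw [Function.update_self, ← sub_add]
        exact dvd_add (h _) (dvd_mul_left _ _)
      · rw [Function.update_of_ne hv]
        exact h v
    refine ⟨_, hcongr, fun i j hi hj => ?_⟩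
    have hjb : j ≠ b := by
      rw [ne_eq, Fin.ext_iff]
      omega
    by_cases hib : i = b
    · by_cases hja : j = a
      · subst hib hja
        rwa [Function.update_self, Function.update_of_ne hjb]
      · refine hp.congr hcongr i j ?_
        rw [Fin.ext_iff] at hib hja
        rw [mem_coNbrs_iff_val]
        omega
    · rw [Function.update_of_ne hib, Function.update_of_ne hjb]
      rw [Fin.ext_iff] at hib
      exact h' i j (by omega) hj

theorem exists_interpolation {p : Fin (n + 2) → Spoly (n + 2)} (m : ℕ) (hm : m ≤ n + 2)
    (h : ∀ i j : Fin (n + 2), i.val < m → j.val < i.val → X i - X j ∣ p i - p j) :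
    ∃ F : Polynomial (Spoly (n + 2)), F.degree < m ∧
      ∀ v : Fin (n + 2), v.val < m → F.eval (X v) = p v := by
  induction m with
  | zero => exact ⟨0, by simp, by simp⟩
  | succ m ih =>
    obtain ⟨F, hF, hFp⟩ := ih (by omega) fun i j hi hj => h i j (by omega) hj
    let b : Fin (n + 2) := ⟨m, by omega⟩
    let s : Finset (Fin (n + 2)) := Finset.univ.filter fun j => j.val < m
    have hs : ∀ j, j ∈ s ↔ j.val < m := fun j => by simp [s]
    have hcard : s.card = m := by
      rw [Fin.card_filter_val_lt, min_eq_right (by omega)]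
    obtain ⟨c, hc⟩ : ∏ j ∈ s, (X b - X j) ∣ p b - F.eval (X b) := by
      refine prod_X_sub_X_dvd (by simp [hs, b]) fun j hj => ?_
      have hj' := (hs j).mp hj
      have e := dvd_sub (h b j (Nat.lt_succ_self m) hj')
        (Polynomial.sub_dvd_eval_sub (X b) (X j) F)
      rwa [hFp j hj', sub_sub_sub_cancel_right] at e
    refine ⟨F + Polynomial.C c * ∏ j ∈ s, (Polynomial.X - Polynomial.C (X j)), ?_, fun v hv => ?_⟩
    · refine (Polynomial.degree_add_le _ _).trans_lt (max_lt ?_ ?_)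
      · exact hF.trans (by exact_mod_cast Nat.lt_succ_self m)
      · refine (Polynomial.degree_mul_le _ _).trans_lt ?_
        refine (add_le_add_left Polynomial.degree_C_le _).trans_lt ?_
        rw [Polynomial.degree_prod]
        simp only [Polynomial.degree_X_sub_C, Finset.sum_const, hcard, nsmul_eq_mul, mul_one,
          zero_add]
        exact_mod_cast Nat.lt_succ_self m
    · simp only [Polynomial.eval_add, Polynomial.eval_mul, Polynomial.eval_C,
        Polynomial.eval_prod, Polynomial.eval_sub, Polynomial.eval_X]
      by_cases hvb : v = b
      · rw [hvb, mul_comm, ← hc, add_sub_cancel]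
      · have hvm : v.val < m := by
          rw [Fin.ext_iff] at hvb
          change v.val ≠ m at hvb
          omega
        rw [Finset.prod_eq_zero ((hs v).mpr hvm) (sub_self _), mul_zero, add_zero, hFp v hvm]

theorem IsSpline.exists_polynomial (hn : 3 ≤ n) {p : Fin (n + 2) → Spoly (n + 2)}
    (hp : IsSpline p) : ∃ F : Polynomial (Spoly (n + 2)), F.degree < n ∧
      ∀ v, coNbrProd v ∣ p v - F.eval (X v) := by
  obtain ⟨p', h, h'⟩ := hp.exists_congr_of_lt hn n (by omega) le_rfl
  obtain ⟨F, hF, hFp⟩ := exists_interpolation n (by omega) h'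
  refine ⟨F, hF, fun v => ?_⟩
  rw [← sub_add_sub_cancel _ (p' v)]
  refine dvd_add (h v) ?_
  by_cases hv : v.val < n
  · simp [hFp v hv]
  · refine prod_X_sub_X_dvd (notMem_coNbrs_self v) fun j hj => ?_
    have hjn : j.val < n := by
      rw [mem_coNbrs_iff_val] at hj
      have := j.isLt
      have := v.isLt
      omega
    have e := dvd_sub (hp.congr h v j hj) (Polynomial.sub_dvd_eval_sub (X v) (X j) F)
    rwa [hFp j hjn, sub_sub_sub_cancel_right] at e

/-- The monic polynomial vanishing at all vertices except `i` and `i + 1`. -/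
noncomputable def edgePoly (i : Fin (n + 2)) : Polynomial (Spoly (n + 2)) :=
  ∏ j ∈ {i, i + 1}ᶜ, (Polynomial.X - Polynomial.C (X j))

theorem card_compl_edge (i : Fin (n + 2)) : ({i, i + 1}ᶜ : Finset (Fin (n + 2))).card = n := by
  rw [Finset.card_compl, Finset.card_pair (by simp), Fintype.card_fin]
  omega

theorem edgePoly_monic (i : Fin (n + 2)) : (edgePoly i).Monic :=
  Polynomial.monic_prod_of_monic _ _ fun _ _ => Polynomial.monic_X_sub_C _

theorem edgePoly_natDegree (i : Fin (n + 2)) : (edgePoly i).natDegree = n := by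
  rw [edgePoly, Polynomial.natDegree_prod_of_monic _ _ fun _ _ => Polynomial.monic_X_sub_C _]
  simp only [Polynomial.natDegree_X_sub_C, Finset.sum_const, card_compl_edge, smul_eq_mul, mul_one]

theorem edgePoly_degree_lt (i : Fin (n + 2)) : (edgePoly i).degree < (n + 1 : ℕ) := by
  rw [Polynomial.degree_eq_natDegree (edgePoly_monic i).ne_zero, edgePoly_natDegree]
  exact_mod_cast Nat.lt_succ_self n

theorem edgePoly_coeff_self (i : Fin (n + 2)) : (edgePoly i).coeff n = 1 := by
  simpa [Polynomial.Monic, Polynomial.leadingCoeff, edgePoly_natDegree] using edgePoly_monic i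

theorem eval_edgePoly (i v : Fin (n + 2)) :
    (edgePoly i).eval (X v) = ∏ j ∈ {i, i + 1}ᶜ, (X v - X j) := by
  simp [edgePoly, Polynomial.eval_prod]

theorem eval_edgePoly_eq_zero {i v : Fin (n + 2)} (h : v ≠ i) (h' : v ≠ i + 1) :
    (edgePoly i).eval (X v) = 0 := by
  rw [eval_edgePoly]
  exact Finset.prod_eq_zero (i := v) (by simp [h, h']) (sub_self _)

theorem add_one_add_one_ne_self (hn : 1 ≤ n) (v : Fin (n + 2)) : v + 1 + 1 ≠ v := by
  rw [ne_eq, Fin.ext_iff, Fin.val_add_one, Fin.val_add_one]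
  simp only [Fin.ext_iff, Fin.val_add_one, Fin.val_last]
  have := v.isLt
  split_ifs <;> omega

theorem eval_edgePoly_self (hn : 1 ≤ n) (v : Fin (n + 2)) :
    (edgePoly v).eval (X v) = coNbrProd v * (X v - X (v - 1)) := by
  have : ({v, v + 1}ᶜ : Finset (Fin (n + 2))) = insert (v - 1) (coNbrs v) := by
    obtain ⟨w, rfl⟩ : ∃ w, v = w + 1 := ⟨v - 1, by simp⟩
    have h1 : w + 1 ≠ w := by simp
    have h2 := add_one_add_one_ne_self hn w
    have h3 : w + 1 + 1 ≠ w + 1 := by simp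
    ext j
    simp only [Finset.mem_compl, Finset.mem_insert, Finset.mem_singleton, mem_coNbrs,
      add_sub_cancel_right, add_left_inj, ne_eq]
    grind
  rw [eval_edgePoly, this, Finset.prod_insert (by simp [mem_coNbrs]), mul_comm, coNbrProd]

theorem eval_edgePoly_sub_one (hn : 1 ≤ n) (v : Fin (n + 2)) :
    (edgePoly (v - 1)).eval (X v) = coNbrProd v * (X v - X (v + 1)) := by
  have : ({v - 1, v - 1 + 1}ᶜ : Finset (Fin (n + 2))) = insert (v + 1) (coNbrs v) := by
    obtain ⟨w, rfl⟩ : ∃ w, v = w + 1 := ⟨v - 1, by simp⟩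
    have h1 : w + 1 ≠ w := by simp
    have h2 := add_one_add_one_ne_self hn w
    have h3 : w + 1 + 1 ≠ w + 1 := by simp
    ext j
    simp only [Finset.mem_compl, Finset.mem_insert, Finset.mem_singleton, mem_coNbrs,
      add_sub_cancel_right, add_left_inj, ne_eq]
    grind
  rw [eval_edgePoly, this, Finset.prod_insert (by simp [mem_coNbrs]), mul_comm, coNbrProd]

theorem eval_sum_edgePoly (hn : 1 ≤ n) (α : Fin (n + 2) → Spoly (n + 2)) (v : Fin (n + 2)) :
    (∑ i, α i • edgePoly i).eval (X v) =
      coNbrProd v * (α v * (X v - X (v - 1)) + α (v - 1) * (X v - X (v + 1))) := by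
  rw [Polynomial.eval_finsetSum, Fintype.sum_eq_add v (v - 1) (by simp [eq_sub_iff_add_eq])]
  · rw [Polynomial.eval_smul, Polynomial.eval_smul, eval_edgePoly_self hn,
      eval_edgePoly_sub_one hn, smul_eq_mul, smul_eq_mul]
    ring
  · rintro i ⟨h, h'⟩
    rw [Polynomial.eval_smul, eval_edgePoly_eq_zero h.symm (fun e => h' (by simp [e])), smul_zero]

theorem sum_edgePoly_degree_lt (α : Fin (n + 2) → Spoly (n + 2)) :
    (∑ i, α i • edgePoly i).degree < (n + 1 : ℕ) :=
  Polynomial.mem_degreeLT.mp <| Submodule.sum_mem _ fun i _ =>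
    Submodule.smul_mem _ _ (Polynomial.mem_degreeLT.mpr (edgePoly_degree_lt i))

theorem eq_zero_of_degree_lt_of_eval_X {F : Polynomial (Spoly (n + 2))} {m : ℕ} (hm : m ≤ n + 2)
    (hF : F.degree < m) (h : ∀ v : Fin (n + 2), v.val < m → F.eval (X v) = 0) : F = 0 := by
  refine Polynomial.eq_zero_of_degree_lt_of_eval_index_eq_zero (v := X)
    (s := Finset.univ.filter fun j : Fin (n + 2) => j.val < m) (X_injective.injOn) ?_
    fun v hv => h v (by simpa using hv)
  rwa [Fin.card_filter_val_lt, min_eq_right hm]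

theorem exists_sum_edgePoly_eval_zero (hn : 3 ≤ n) {F : Polynomial (Spoly (n + 2))}
    (h : ∀ v, coNbrProd v ∣ F.eval (X v)) :
    ∃ α : Fin (n + 2) → Spoly (n + 2), (∑ i, α i • edgePoly i).eval (X 0) = F.eval (X 0) := by
  let z : Fin (n + 2) := Fin.last (n + 1)
  have h1 : (1 : Fin (n + 2)).val = 1 := rfl
  have h0 : (0 : Fin (n + 2)).val = 0 := rfl
  have hz : z.val = n + 1 := rfl
  have hz0 : (0 : Fin (n + 2)) - 1 = z := by
    rw [sub_eq_iff_eq_add, Fin.ext_iff, Fin.val_add_one, if_pos rfl, h0]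
  obtain ⟨a, ha⟩ := h 0
  let τ : Fin (n + 2) → Fin (n + 2) := fun j => if j = 1 ∨ j = z then 0 else j
  have hτ0 : τ 0 = 0 := by simp [τ]
  have hτ1 : τ 1 = 0 := by simp [τ]
  have hτz : τ z = 0 := by simp [τ]
  have hτs : ∀ j ∈ coNbrs 0, τ j = j := by
    intro j hj
    refine if_neg ?_
    rw [mem_coNbrs_iff_val] at hj
    rw [Fin.ext_iff, Fin.ext_iff, h1, hz]
    omega
  have hτa : rename τ a = 0 := by
    have e0 : rename τ (F.eval (X 0)) = 0 := by
      have e1 : rename τ (F.eval (X 1)) = 0 := by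
        obtain ⟨b, hb⟩ := h 1
        have hz1 : z ∈ coNbrs 1 := by
          rw [mem_coNbrs_iff_val]
          omega
        rw [hb, map_mul, coNbrProd, map_prod, Finset.prod_eq_zero hz1 (by simp [hτ1, hτz]),
          zero_mul]
      have e := X_sub_X_dvd_rename (Polynomial.sub_dvd_eval_sub (X 0) (X 1) F) τ
      rwa [hτ0, hτ1, sub_self, zero_dvd_iff, e1, sub_zero] at e
    rw [ha, map_mul, coNbrProd, rename_prod_X_sub_X hτs, hτ0] at e0
    exact (mul_eq_zero.mp e0).resolve_left (coNbrProd_ne_zero 0)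
  have hamem : a ∈ Ideal.span {X 0 - X 1, X 0 - X z} := by
    rw [← sub_zero a, ← hτa]
    refine sub_rename_mem _ τ (fun j => ?_) a
    by_cases hj : j = 1 ∨ j = z
    · rw [show τ j = 0 from if_pos hj, ← neg_sub (X 0), neg_mem_iff]
      rcases hj with rfl | rfl <;> exact Ideal.subset_span (by simp)
    · simp [show τ j = j from if_neg hj]
  obtain ⟨u, v, rfl⟩ := Ideal.mem_span_pair.mp hamem
  refine ⟨Pi.single 0 v + Pi.single z u, ?_⟩
  have hzn : z ≠ 0 := by
    rw [ne_eq, Fin.ext_iff]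
    omega
  rw [eval_sum_edgePoly (by omega), ha, hz0, zero_add]
  simp only [Pi.add_apply, Pi.single_eq_same, ne_eq, hzn, hzn.symm, not_false_eq_true,
    Pi.single_eq_of_ne, add_zero, zero_add]
  ring

theorem exists_eq_sum_edgePoly (hn : 3 ≤ n) {F : Polynomial (Spoly (n + 2))}
    (hF : F.degree < (n + 1 : ℕ)) (h : ∀ v, coNbrProd v ∣ F.eval (X v)) :
    ∃ α : Fin (n + 2) → Spoly (n + 2), F = ∑ i, α i • edgePoly i := by
  have key : ∀ m, 1 ≤ m → m ≤ n + 1 → ∃ α : Fin (n + 2) → Spoly (n + 2),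
      ∀ v : Fin (n + 2), v.val < m → (F - ∑ i, α i • edgePoly i).eval (X v) = 0 := by
    intro m hm
    induction m, hm using Nat.le_induction with
    | base =>
      intro _
      obtain ⟨α, hα⟩ := exists_sum_edgePoly_eval_zero hn h
      refine ⟨α, fun v hv => ?_⟩
      obtain rfl : v = 0 := Fin.ext (by simpa using hv)
      rw [Polynomial.eval_sub, hα, sub_self]
    | succ m hm ih =>
      intro hmn
      obtain ⟨α, hα⟩ := ih (by omega)
      set F' := F - ∑ i, α i • edgePoly i with hF'
      let b : Fin (n + 2) := ⟨m, by omega⟩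
      have hb : b.val = m := rfl
      obtain ⟨c, hc⟩ : (edgePoly b).eval (X b) ∣ F'.eval (X b) := by
        rw [eval_edgePoly]
        refine prod_X_sub_X_dvd (by simp) fun j hj => ?_
        by_cases hjb : j ∈ coNbrs b
        · refine (Finset.dvd_prod_of_mem (fun j => (X b - X j : Spoly (n + 2))) hjb).trans ?_
          rw [hF', Polynomial.eval_sub, eval_sum_edgePoly (by omega)]
          exact dvd_sub (h b) (dvd_mul_right _ _)
        · have hjm : j.val < m := by
            simp only [Finset.mem_compl, Finset.mem_insert, Finset.mem_singleton, Fin.ext_iff,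
              Fin.val_add_one, Fin.val_last] at hj
            rw [mem_coNbrs_iff_val] at hjb
            have := j.isLt
            split_ifs at hj <;> omega
          simpa [hα j hjm] using Polynomial.sub_dvd_eval_sub (X b) (X j) F'
      refine ⟨α + Pi.single b c, fun v hv => ?_⟩
      have e : F - ∑ i, (α + Pi.single b c : Fin (n + 2) → Spoly (n + 2)) i • edgePoly i =
          F' - c • edgePoly b := by
        simp [hF', add_smul, Finset.sum_add_distrib, Pi.single_apply, ite_smul, sub_sub]
      rw [e, Polynomial.eval_sub, Polynomial.eval_smul]
      by_cases hvb : v = b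
      · rw [hvb, hc, smul_eq_mul, mul_comm, sub_self]
      · have hvb' : v.val ≠ m := fun e => hvb (Fin.ext e)
        rw [hα v (by omega), eval_edgePoly_eq_zero hvb, smul_zero, sub_zero]
        simp only [ne_eq, Fin.ext_iff, Fin.val_add_one, Fin.val_last]
        split_ifs <;> omega
  obtain ⟨α, hα⟩ := key (n + 1) (by omega) le_rfl
  refine ⟨α, sub_eq_zero.mp (eq_zero_of_degree_lt_of_eval_X (by omega) ?_ hα)⟩
  exact (Polynomial.degree_sub_le _ _).trans_lt (max_lt hF (sum_edgePoly_degree_lt α))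

theorem sum_edgePoly_coeff_self (α : Fin (n + 2) → Spoly (n + 2)) :
    (∑ i, α i • edgePoly i).coeff n = ∑ i, α i := by
  simp [edgePoly_coeff_self]

theorem sum_edgePoly_edge_eq_zero (hn : 1 ≤ n) (c : Spoly (n + 2)) :
    ∑ i : Fin (n + 2), (c * (X i - X (i + 1))) • edgePoly i = 0 := by
  refine eq_zero_of_degree_lt_of_eval_X (m := n + 1) (by omega) (sum_edgePoly_degree_lt _)
    fun v _ => ?_
  rw [eval_sum_edgePoly hn, sub_add_cancel]
  ring

theorem exists_eq_of_sum_edgePoly_eq_zero (hn : 1 ≤ n) {α : Fin (n + 2) → Spoly (n + 2)}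
    (h : ∑ i, α i • edgePoly i = 0) : ∃ c, ∀ i, α i = c * (X i - X (i + 1)) := by
  have key : ∀ v : Fin (n + 2), α (v + 1) * (X v - X (v + 1)) =
      α v * (X (v + 1) - X (v + 1 + 1)) := by
    intro v
    have e := eval_sum_edgePoly hn α (v + 1)
    rw [h, Polynomial.eval_zero, add_sub_cancel_right, eq_comm, mul_eq_zero] at e
    linear_combination - e.resolve_left (coNbrProd_ne_zero _)
  have hne : ∀ v : Fin (n + 2), v ≠ v + 1 := fun v => by simp
  have hdvd : ∀ v : Fin (n + 2), X v - X (v + 1) ∣ α v := by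
    intro v
    have e : X v - X (v + 1) ∣ α v * (X (v + 1) - X (v + 1 + 1)) :=
      ⟨_, (key v).symm.trans (mul_comm _ _)⟩
    refine ((prime_X_sub_X (hne v)).dvd_or_dvd e).resolve_right fun e' => ?_
    rw [X_sub_X_dvd_iff, map_sub, rename_X, rename_X, Function.update_of_ne (hne v).symm,
      Function.update_of_ne (add_one_add_one_ne_self hn v), sub_eq_zero] at e'
    exact hne (v + 1) (X_injective e')
  choose c hc using hdvd
  have hcc : ∀ v, c (v + 1) = c v := by
    intro v
    have e := key v
    rw [hc, hc v] at e
    refine mul_left_cancel₀ (mul_ne_zero (X_sub_X_ne_zero (hne v))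
      (X_sub_X_ne_zero (hne (v + 1)))) ?_
    linear_combination e
  have hc0 : ∀ v, c v = c 0 := by
    intro v
    induction v using Fin.induction with
    | zero => rfl
    | succ i ih => rw [← ih, ← Fin.coeSucc_eq_succ, hcc]
  exact ⟨c 0, fun i => by rw [hc i, hc0 i, mul_comm]⟩

theorem edgePoly_coeff_isHomogeneous (i : Fin (n + 2)) (k : ℕ) :
    ((edgePoly i).coeff k).IsHomogeneous (n - k) := by
  have key : ∀ (s : Finset (Fin (n + 2))) (k : ℕ),
      ((∏ j ∈ s, (Polynomial.X - Polynomial.C (X j : Spoly (n + 2)))).coeff k).IsHomogeneous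
        (s.card - k) := by
    intro s
    induction s using Finset.induction_on with
    | empty =>
      intro k
      rw [Finset.prod_empty, Polynomial.coeff_one]
      split_ifs
      · simpa using isHomogeneous_one _ _
      · exact isHomogeneous_zero _ _ _
    | insert a s ha ih =>
      intro k
      have hdeg : (∏ j ∈ s, (Polynomial.X - Polynomial.C (X j : Spoly (n + 2)))).natDegree
          = s.card := by
        rw [Polynomial.natDegree_prod_of_monic _ _ fun _ _ => Polynomial.monic_X_sub_C _]
        simp
      rw [Finset.prod_insert ha, Finset.card_insert_of_notMem ha, sub_mul, Polynomial.coeff_sub,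
        Polynomial.coeff_C_mul]
      refine IsHomogeneous.sub ?_ ?_
      · cases k with
        | zero => simpa using isHomogeneous_zero _ _ _
        | succ k => simpa [Polynomial.coeff_X_mul] using ih k
      · by_cases hk : k ≤ s.card
        · rw [show s.card + 1 - k = 1 + (s.card - k) by omega]
          exact (isHomogeneous_X _ _).mul (ih k)
        · rw [Polynomial.coeff_eq_zero_of_natDegree_lt (by omega), mul_zero]
          exact isHomogeneous_zero _ _ _
  have h := key {i, i + 1}ᶜ k
  rwa [card_compl_edge] at h

/-- The linear map extending a tuple by an entry that makes the sum of all entries vanish. -/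
noncomputable def extendSumZero :
    (Fin (n + 1) → Spoly (n + 2)) →ₗ[Spoly (n + 2)] (Fin (n + 2) → Spoly (n + 2)) where
  toFun w := Fin.snoc w (-∑ i, w i)
  map_add' w w' := by
    funext i
    refine Fin.lastCases ?_ (fun i ↦ ?_) i
    · simp [Finset.sum_add_distrib]; ring
    · simp
  map_smul' c w := by
    funext i
    refine Fin.lastCases ?_ (fun i ↦ ?_) i
    · simp [Finset.mul_sum]
    · simp

@[simp]
theorem extendSumZero_castSucc (w : Fin (n + 1) → Spoly (n + 2)) (i : Fin (n + 1)) :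
    extendSumZero w i.castSucc = w i := by
  simp [extendSumZero]

@[simp]
theorem extendSumZero_last (w : Fin (n + 1) → Spoly (n + 2)) :
    extendSumZero w (Fin.last (n + 1)) = -∑ i, w i := by
  simp [extendSumZero]

theorem sum_extendSumZero (w : Fin (n + 1) → Spoly (n + 2)) : ∑ i, extendSumZero w i = 0 := by
  simp [Fin.sum_univ_castSucc]

theorem extendSumZero_restrict {α : Fin (n + 2) → Spoly (n + 2)} (h : ∑ i, α i = 0) :
    extendSumZero (fun i ↦ α i.castSucc) = α := by
  funext i
  refine Fin.lastCases ?_ (fun i ↦ ?_) i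
  · rw [extendSumZero_last, ← sub_eq_zero, ← neg_eq_zero, ← h, Fin.sum_univ_castSucc α]
    ring
  · simp

/-- The tuple of values on the variables of the derivation with prescribed coefficients in terms of
the generators `∑ v, x_v ^ k ∂_v` and `coNbrProd v ∂_v`. -/
noncomputable def tupleMap : ((Fin n ⊕ Fin (n + 2)) → Spoly (n + 2)) →ₗ[Spoly (n + 2)]
    (Fin (n + 2) → Spoly (n + 2)) :=
  LinearMap.pi fun v ↦
    ∑ k : Fin n, (X v ^ (k : ℕ) : Spoly (n + 2)) • LinearMap.proj (Sum.inl k) +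
      coNbrProd v • LinearMap.proj (Sum.inr v)

/-- The polynomial whose lower coefficients are given by a tuple. -/
noncomputable def tuplePoly (u : (Fin n ⊕ Fin (n + 2)) → Spoly (n + 2)) :
    Polynomial (Spoly (n + 2)) :=
  ∑ k : Fin n, Polynomial.C (u (Sum.inl k)) * Polynomial.X ^ (k : ℕ)

theorem tuplePoly_degree_lt (u : (Fin n ⊕ Fin (n + 2)) → Spoly (n + 2)) :
    (tuplePoly u).degree < n :=
  Polynomial.degree_sum_fin_lt _

theorem tuplePoly_coeff (u : (Fin n ⊕ Fin (n + 2)) → Spoly (n + 2)) (k : Fin n) :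
    (tuplePoly u).coeff k = u (Sum.inl k) := by
  simp [tuplePoly, Polynomial.coeff_C_mul, Polynomial.coeff_X_pow, Fin.val_inj]

theorem eq_tuplePoly {F : Polynomial (Spoly (n + 2))} (hF : F.degree < n)
    {u : (Fin n ⊕ Fin (n + 2)) → Spoly (n + 2)} (h : ∀ k : Fin n, u (Sum.inl k) = F.coeff k) :
    tuplePoly u = F := by
  ext1 k
  rcases lt_or_ge k n with hk | hk
  · exact (tuplePoly_coeff u ⟨k, hk⟩).trans (h ⟨k, hk⟩)
  · rw [Polynomial.coeff_eq_zero_of_degree_lt (hF.trans_le (by exact_mod_cast hk)),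
      Polynomial.coeff_eq_zero_of_degree_lt
        ((tuplePoly_degree_lt u).trans_le (by exact_mod_cast hk))]

theorem tupleMap_apply (u : (Fin n ⊕ Fin (n + 2)) → Spoly (n + 2)) (v : Fin (n + 2)) :
    tupleMap u v = (tuplePoly u).eval (X v) + coNbrProd v * u (Sum.inr v) := by
  simp only [tupleMap, tuplePoly, LinearMap.pi_apply, LinearMap.add_apply, LinearMap.sum_apply,
    LinearMap.smul_apply, LinearMap.proj_apply, smul_eq_mul, Polynomial.eval_finsetSum,
    Polynomial.eval_mul, Polynomial.eval_C, Polynomial.eval_pow, Polynomial.eval_X]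
  simp only [mul_comm]

theorem isSpline_eval (F : Polynomial (Spoly (n + 2))) :
    IsSpline fun v : Fin (n + 2) ↦ F.eval (X v) :=
  fun _ _ _ ↦ Polynomial.sub_dvd_eval_sub _ _ _

theorem isSpline_tupleMap (u : (Fin n ⊕ Fin (n + 2)) → Spoly (n + 2)) : IsSpline (tupleMap u) :=
  (isSpline_eval (tuplePoly u)).congr fun v ↦ by simp [tupleMap_apply]

theorem IsSpline.exists_tupleMap_eq (hn : 3 ≤ n) {p : Fin (n + 2) → Spoly (n + 2)}
    (hp : IsSpline p) : ∃ u, tupleMap u = p := by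
  obtain ⟨F, hF, h⟩ := hp.exists_polynomial hn
  choose a ha using h
  refine ⟨Sum.elim (fun k ↦ F.coeff k) a, funext fun v ↦ ?_⟩
  rw [tupleMap_apply, eq_tuplePoly hF fun k ↦ rfl, Sum.elim_inr, ← ha v]
  ring

/-- The map `S ^ (ℓ - 1) → S ^ (2 ℓ - 2)` of the resolution, on `ℓ = n + 2` vertices: it records the
relations between the generators that are given by the polynomials `edgePoly i`. -/
noncomputable def relMap : (Fin (n + 1) → Spoly (n + 2)) →ₗ[Spoly (n + 2)]
    ((Fin n ⊕ Fin (n + 2)) → Spoly (n + 2)) :=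
  let π (i : Fin (n + 2)) : (Fin (n + 2) → Spoly (n + 2)) →ₗ[Spoly (n + 2)] Spoly (n + 2) :=
    LinearMap.proj i
  LinearMap.pi (Sum.elim (fun k ↦ ∑ i, (edgePoly i).coeff k • π i)
    fun v ↦ (X (v - 1) - X v : Spoly (n + 2)) • π v +
      (X (v + 1) - X v : Spoly (n + 2)) • π (v - 1)) ∘ₗ extendSumZero

theorem relMap_inl (w : Fin (n + 1) → Spoly (n + 2)) (k : Fin n) :
    relMap w (Sum.inl k) = (∑ i, extendSumZero w i • edgePoly i).coeff k := by
  simp [relMap, Polynomial.finsetSum_coeff, mul_comm]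

theorem relMap_inr (w : Fin (n + 1) → Spoly (n + 2)) (v : Fin (n + 2)) :
    relMap w (Sum.inr v) = -(extendSumZero w v * (X v - X (v - 1)) +
      extendSumZero w (v - 1) * (X v - X (v + 1))) := by
  simp [relMap]; ring

theorem sum_edgePoly_degree_lt_of_sum_eq_zero {α : Fin (n + 2) → Spoly (n + 2)}
    (h : ∑ i, α i = 0) : (∑ i, α i • edgePoly i).degree < n := by
  rw [Polynomial.degree_lt_iff_coeff_zero]
  intro m hm
  rcases hm.eq_or_lt with rfl | hm
  · rw [sum_edgePoly_coeff_self, h]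
  · exact Polynomial.coeff_eq_zero_of_degree_lt
      ((sum_edgePoly_degree_lt α).trans_le (by exact_mod_cast hm))

theorem tuplePoly_relMap (w : Fin (n + 1) → Spoly (n + 2)) :
    tuplePoly (relMap w) = ∑ i, extendSumZero w i • edgePoly i :=
  eq_tuplePoly (sum_edgePoly_degree_lt_of_sum_eq_zero (sum_extendSumZero w)) (relMap_inl w)

theorem range_relMap (hn : 3 ≤ n) :
    LinearMap.range (relMap (n := n)) = LinearMap.ker tupleMap := by
  ext u
  rw [LinearMap.mem_range, LinearMap.mem_ker]
  constructor
  · rintro ⟨w, rfl⟩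
    funext v
    rw [tupleMap_apply, tuplePoly_relMap, eval_sum_edgePoly (by lia), relMap_inr, mul_neg,
      add_neg_cancel, Pi.zero_apply]
  · intro hu
    have hu' (v) : (tuplePoly u).eval (X v) = -(coNbrProd v * u (Sum.inr v)) := by
      rw [eq_neg_iff_add_eq_zero, ← tupleMap_apply, hu, Pi.zero_apply]
    obtain ⟨α, hα⟩ := exists_eq_sum_edgePoly hn
      ((tuplePoly_degree_lt u).trans (by exact_mod_cast n.lt_succ_self))
      fun v ↦ by rw [hu', dvd_neg]; exact dvd_mul_right _ _
    have h0 : ∑ i, α i = 0 := by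
      rw [← sum_edgePoly_coeff_self, ← hα]
      exact Polynomial.coeff_eq_zero_of_degree_lt (tuplePoly_degree_lt u)
    refine ⟨fun i ↦ α i.castSucc, funext fun x ↦ ?_⟩
    cases x with
    | inl k => rw [relMap_inl, extendSumZero_restrict h0, ← hα, tuplePoly_coeff]
    | inr v =>
      rw [relMap_inr, extendSumZero_restrict h0]
      have h := hu' v
      rw [hα, eval_sum_edgePoly (by lia), ← mul_neg] at h
      rw [mul_left_cancel₀ (coNbrProd_ne_zero v) h, neg_neg]

/-- The map `S → S ^ (ℓ - 1)` of the resolution, on `ℓ = n + 2` vertices. -/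
noncomputable def edgeMap : Spoly (n + 2) →ₗ[Spoly (n + 2)] (Fin (n + 1) → Spoly (n + 2)) :=
  LinearMap.toSpanSingleton _ _ fun i ↦ X i.castSucc - X (i.castSucc + 1)

theorem edgeMap_apply (c : Spoly (n + 2)) (i : Fin (n + 1)) :
    edgeMap c i = c * (X i.castSucc - X (i.castSucc + 1)) := by
  simp [edgeMap]

theorem sum_mul_edge (c : Spoly (n + 2)) :
    ∑ i : Fin (n + 2), c * (X i - X (i + 1) : Spoly (n + 2)) = 0 := by
  have h := Equiv.sum_comp (Equiv.addRight (1 : Fin (n + 2))) fun i ↦ (X i : Spoly (n + 2))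
  rw [Equiv.coe_addRight] at h
  rw [← Finset.mul_sum, Finset.sum_sub_distrib, h, sub_self, mul_zero]

theorem extendSumZero_edgeMap (c : Spoly (n + 2)) :
    extendSumZero (edgeMap c) = fun i ↦ c * (X i - X (i + 1)) := by
  rw [← extendSumZero_restrict (sum_mul_edge c)]
  exact congrArg extendSumZero (funext (edgeMap_apply c))

theorem range_edgeMap (hn : 1 ≤ n) :
    LinearMap.range (edgeMap (n := n)) = LinearMap.ker relMap := by
  ext w
  rw [LinearMap.mem_range, LinearMap.mem_ker]
  constructor
  · rintro ⟨c, rfl⟩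
    funext x
    cases x with
    | inl k => rw [relMap_inl, extendSumZero_edgeMap, sum_edgePoly_edge_eq_zero hn]; simp
    | inr v => rw [relMap_inr, extendSumZero_edgeMap]; simp; ring
  · intro hw
    obtain ⟨c, hc⟩ := exists_eq_of_sum_edgePoly_eq_zero hn (α := extendSumZero w) (by
      rw [← tuplePoly_relMap, hw]; simp [tuplePoly])
    exact ⟨c, funext fun i ↦ by rw [edgeMap_apply, ← hc, extendSumZero_castSucc]⟩

theorem edgeMap_injective : Function.Injective (edgeMap (n := n)) := by
  intro c c' h
  have := congrFun h 0
  rw [edgeMap_apply, edgeMap_apply] at this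
  exact mul_right_cancel₀ (X_sub_X_ne_zero (by simp)) this

theorem edgeMap_one_isHomogeneous (i : Fin (n + 1)) : (edgeMap (n := n) 1 i).IsHomogeneous 1 := by
  rw [edgeMap_apply, one_mul]
  exact (isHomogeneous_X _ _).sub (isHomogeneous_X _ _)

theorem extendSumZero_single_isHomogeneous (j : Fin (n + 1)) (i : Fin (n + 2)) :
    (extendSumZero (Pi.single j 1 : Fin (n + 1) → Spoly (n + 2)) i).IsHomogeneous 0 := by
  refine Fin.lastCases ?_ (fun i ↦ ?_) i
  · rw [extendSumZero_last, Finset.sum_pi_single']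
    simpa using (isHomogeneous_one (Fin (n + 2)) ℚ).neg
  · rw [extendSumZero_castSucc, Pi.single_apply]
    split_ifs
    exacts [isHomogeneous_one _ _, isHomogeneous_zero _ _ _]

theorem relMap_single_inl_isHomogeneous (j : Fin (n + 1)) (k : Fin n) :
    (relMap (Pi.single j 1 : Fin (n + 1) → Spoly (n + 2)) (Sum.inl k)).IsHomogeneous
      (n - k) := by
  rw [relMap_inl, Polynomial.finsetSum_coeff]
  refine IsHomogeneous.sum _ _ _ fun i _ ↦ ?_
  rw [Polynomial.coeff_smul, smul_eq_mul, ← zero_add (n - (k : ℕ))]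
  exact (extendSumZero_single_isHomogeneous j i).mul (edgePoly_coeff_isHomogeneous i k)

theorem relMap_single_inr_isHomogeneous (j : Fin (n + 1)) (v : Fin (n + 2)) :
    (relMap (Pi.single j 1 : Fin (n + 1) → Spoly (n + 2)) (Sum.inr v)).IsHomogeneous 1 := by
  have h (i j' : Fin (n + 2)) := (extendSumZero_single_isHomogeneous j i).mul
    ((isHomogeneous_X ℚ v).sub (isHomogeneous_X ℚ j'))
  rw [zero_add] at h
  rw [relMap_inr]
  exact ((h _ _).add (h _ _)).neg

theorem mem_logDer_iff {θ : Derivation ℚ (Spoly (n + 2)) (Spoly (n + 2))} :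
    θ ∈ logDer (n + 2) (SimpleGraph.cycleGraph (n + 2))ᶜ ↔ IsSpline fun v ↦ θ (X v) :=
  forall_congr' fun _ ↦ forall_congr' fun _ ↦ by rw [compl_cycleGraph_adj]

/-- The map `S ^ (2 ℓ - 2) → D(A(G))` of the resolution, on `ℓ = n + 2` vertices. -/
noncomputable def genMap : ((Fin n ⊕ Fin (n + 2)) → Spoly (n + 2)) →ₗ[Spoly (n + 2)]
    logDer (n + 2) (SimpleGraph.cycleGraph (n + 2))ᶜ where
  toFun u := ⟨mkDerivation ℚ (tupleMap u), mem_logDer_iff.2 <| by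
    simpa only [mkDerivation_X] using isSpline_tupleMap u⟩
  map_add' u u' := Subtype.ext <| derivation_ext fun v ↦ by simp [mkDerivation_X]
  map_smul' c u := Subtype.ext <| derivation_ext fun v ↦ by simp [mkDerivation_X]

theorem genMap_apply_X (u : (Fin n ⊕ Fin (n + 2)) → Spoly (n + 2)) (v : Fin (n + 2)) :
    (genMap u).1 (X v) = tupleMap u v :=
  mkDerivation_X _ _ _

theorem ker_genMap : LinearMap.ker (genMap (n := n)) = LinearMap.ker tupleMap := by
  ext u
  rw [LinearMap.mem_ker, LinearMap.mem_ker]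
  refine ⟨fun h ↦ funext fun v ↦ ?_, fun h ↦ Subtype.ext <| derivation_ext fun v ↦ ?_⟩
  · rw [← genMap_apply_X, h]; rfl
  · rw [genMap_apply_X, h]; rfl

theorem genMap_surjective (hn : 3 ≤ n) : Function.Surjective (genMap (n := n)) := by
  rintro ⟨θ, hθ⟩
  obtain ⟨u, hu⟩ := (mem_logDer_iff.1 hθ).exists_tupleMap_eq hn
  exact ⟨u, Subtype.ext <| derivation_ext fun v ↦ by rw [genMap_apply_X, hu]⟩

end Antihole

section ProjectiveDimension

variable {R : Type} [CommRing R]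

theorem hasProjectiveDimensionLT_of_pdLE {M : ModuleCat R} {k : ℕ} (h : pdLE M k) :
    HasProjectiveDimensionLT M (k + 1) := by
  obtain ⟨P, hP⟩ := h
  refine HasProjectiveDimensionLT.mk fun i hi Y e ↦ ?_
  obtain ⟨f, hf, rfl⟩ := P.extMk_surjective e (i + 1) rfl
  obtain rfl : f = 0 := (hP i (by lia)).eq_of_src _ _
  exact P.extMk_zero _ _

variable {P₀ P₁ P₂ M : Type} [AddCommGroup P₀] [AddCommGroup P₁] [AddCommGroup P₂] [AddCommGroup M]
  [Module R P₀] [Module R P₁] [Module R P₂] [Module R M]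

/-- The complex `0 → P₂ → P₁ → P₀`. -/
noncomputable def twoStepComplex {f : P₂ →ₗ[R] P₁} {g : P₁ →ₗ[R] P₀} (hfg : g ∘ₗ f = 0) :
    ChainComplex (ModuleCat R) ℕ :=
  ChainComplex.mk (.of R P₀) (.of R P₁) (.of R P₂) (ModuleCat.ofHom g) (ModuleCat.ofHom f)
    (by rw [← ModuleCat.ofHom_comp, hfg]; rfl) fun _ ↦ ⟨.of R PUnit, 0, by simp⟩

section twoStepComplex

variable {f : P₂ →ₗ[R] P₁} {g : P₁ →ₗ[R] P₀} (hfg : g ∘ₗ f = 0)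

theorem twoStepComplex_d_one_zero : (twoStepComplex hfg).d 1 0 = ModuleCat.ofHom g :=
  ChainComplex.mk_d_1_0 ..

theorem twoStepComplex_d_two_one : (twoStepComplex hfg).d 2 1 = ModuleCat.ofHom f :=
  ChainComplex.mk_d_2_1 ..

theorem twoStepComplex_subsingleton (n : ℕ) : Subsingleton ((twoStepComplex hfg).X (n + 3)) :=
  inferInstanceAs (Subsingleton PUnit)

theorem twoStepComplex_exactAt (hf : Function.Injective f) (h : Function.Exact f g) (n : ℕ) :
    (twoStepComplex hfg).ExactAt (n + 1) := by
  rw [HomologicalComplex.exactAt_iff' _ (n + 1 + 1) (n + 1) n (by simp) (by simp),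
    ShortComplex.ShortExact.moduleCat_exact_iff_function_exact]
  match n with
  | 0 =>
    change Function.Exact ((twoStepComplex hfg).d 2 1) ((twoStepComplex hfg).d 1 0)
    rwa [twoStepComplex_d_one_zero, twoStepComplex_d_two_one]
  | 1 =>
    change Function.Exact ((twoStepComplex hfg).d 3 2) ((twoStepComplex hfg).d 2 1)
    rw [twoStepComplex_d_two_one]
    have := twoStepComplex_subsingleton hfg 0
    refine fun x ↦ ⟨fun hx ↦ ⟨0, ?_⟩, ?_⟩
    · exact (map_zero _).trans (hf (hx.trans (map_zero f).symm)).symm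
    · rintro ⟨y, rfl⟩
      rw [Subsingleton.elim y 0, map_zero, map_zero]
  | n + 2 =>
    have := twoStepComplex_subsingleton hfg n
    have := twoStepComplex_subsingleton hfg (n + 1)
    change Function.Exact ((twoStepComplex hfg).d (n + 4) (n + 3))
      ((twoStepComplex hfg).d (n + 3) (n + 2))
    exact fun x ↦ ⟨fun _ ↦ ⟨0, Subsingleton.elim _ _⟩,
      fun _ ↦ by rw [Subsingleton.elim x 0, map_zero]⟩

theorem twoStepComplex_projective [Module.Projective R P₀] [Module.Projective R P₁]
    [Module.Projective R P₂] (n : ℕ) : Projective ((twoStepComplex hfg).X n) :=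
  match n with
  | 0 => inferInstanceAs (Projective (ModuleCat.of R P₀))
  | 1 => inferInstanceAs (Projective (ModuleCat.of R P₁))
  | 2 => inferInstanceAs (Projective (ModuleCat.of R P₂))
  | _ + 3 => inferInstanceAs (Projective (ModuleCat.of R PUnit))

end twoStepComplex

theorem pdLE_two_of_exact [Module.Projective R P₀] [Module.Projective R P₁]
    [Module.Projective R P₂] {f : P₂ →ₗ[R] P₁} {g : P₁ →ₗ[R] P₀} {h : P₀ →ₗ[R] M}
    (hf : Function.Injective f) (hfg : Function.Exact f g) (hgh : Function.Exact g h)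
    (hh : Function.Surjective h) : pdLE (ModuleCat.of R M) 2 := by
  have hgf := hfg.linearMap_comp_eq_zero
  have w : (twoStepComplex hgf).d 1 0 ≫ ModuleCat.ofHom h = 0 := by
    rw [twoStepComplex_d_one_zero]
    exact ModuleCat.hom_ext hgh.linearMap_comp_eq_zero
  let P : ProjectiveResolution (ModuleCat.of R M) :=
    { complex := twoStepComplex hgf
      projective := twoStepComplex_projective hgf
      π := (ChainComplex.toSingle₀Equiv _ _).symm ⟨ModuleCat.ofHom h, w⟩
      quasiIso := ⟨fun n ↦ by
        cases n with
        | zero =>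
          rw [ChainComplex.quasiIsoAt₀_iff, ShortComplex.quasiIso_iff_of_zeros']
          · refine (ShortComplex.exact_and_epi_g_iff_of_iso
              (S₂ := ShortComplex.mk _ _ w) ?_).2 ⟨?_, ?_⟩
            · exact ShortComplex.isoMk (Iso.refl _) (Iso.refl _) (Iso.refl _)
                ((Category.id_comp _).trans (Category.comp_id _).symm)
                ((Category.id_comp _).trans (Category.comp_id _).symm)
            · rw [ShortComplex.ShortExact.moduleCat_exact_iff_function_exact]
              change Function.Exact ((twoStepComplex hgf).d 1 0) h
              rwa [twoStepComplex_d_one_zero]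
            · exact (ModuleCat.epi_iff_surjective _).2 hh
          all_goals rfl
        | succ n =>
          rw [quasiIsoAt_iff_exactAt']
          · exact twoStepComplex_exactAt hgf hf hfg n
          · exact ChainComplex.exactAt_succ_single_obj _ _⟩ }
  refine ⟨P, fun i hi ↦ ?_⟩
  obtain ⟨n, rfl⟩ := Nat.exists_eq_add_of_lt hi
  have := twoStepComplex_subsingleton hgf n
  rw [show 2 + n + 1 = n + 3 by lia]
  exact ModuleCat.isZero_of_subsingleton ((twoStepComplex hgf).X (n + 3))

theorem exists_leftInverse_of_pdLE [Module.Projective R P₀] [Module.Projective R P₁]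
    {f : P₂ →ₗ[R] P₁} {g : P₁ →ₗ[R] P₀} {h : P₀ →ₗ[R] M}
    (hf : Function.Injective f) (hfg : Function.Exact f g) (hgh : Function.Exact g h)
    (hh : Function.Surjective h) {k : ℕ} (hk : k ≤ 1) (hM : pdLE (ModuleCat.of R M) k) :
    ∃ r : P₁ →ₗ[R] P₂, r ∘ₗ f = LinearMap.id := by
  have hM₂ : HasProjectiveDimensionLT (ModuleCat.of R M) 2 := by
    have := hasProjectiveDimensionLT_of_pdLE hM
    exact hasProjectiveDimensionLT_of_ge _ (k + 1) 2 (by lia)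
  let S : ShortComplex (ModuleCat R) :=
    .mk (ModuleCat.ofHom (LinearMap.range g).subtype) (ModuleCat.ofHom h)
      (ModuleCat.hom_ext <| LinearMap.ext fun x ↦ (hgh _).2 x.2)
  have hS : S.ShortExact :=
    { exact := (ShortComplex.ShortExact.moduleCat_exact_iff_function_exact _).2 fun x ↦ by
        exact (hgh x).trans ⟨fun hx ↦ ⟨⟨x, hx⟩, rfl⟩, fun ⟨y, hy⟩ ↦ hy ▸ y.2⟩
      mono_f := (ModuleCat.mono_iff_injective _).2 Subtype.val_injective
      epi_g := (ModuleCat.epi_iff_surjective _).2 hh }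
  have hrange : HasProjectiveDimensionLT (ModuleCat.of R (LinearMap.range g)) 1 :=
    hS.hasProjectiveDimensionLT_X₁ 1 (inferInstanceAs
      (HasProjectiveDimensionLT (ModuleCat.of R P₀) 1)) hM₂
  have : Module.Projective R (LinearMap.range g) :=
    (IsProjective.iff_projective _).2 (projective_iff_hasProjectiveDimensionLT_one.2 hrange)
  have hfg' : Function.Exact f g.rangeRestrict := fun x ↦ by rw [← hfg x, Subtype.ext_iff]; rfl
  exact ((hfg'.split_tfae hf g.surjective_rangeRestrict).out 0 1 rfl rfl).1
    (Module.projective_lifting_property g.rangeRestrict LinearMap.id g.surjective_rangeRestrict)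

theorem pd_eq_two_of_exact [Module.Projective R P₀] [Module.Projective R P₁]
    [Module.Projective R P₂] {f : P₂ →ₗ[R] P₁} {g : P₁ →ₗ[R] P₀} {h : P₀ →ₗ[R] M}
    (hf : Function.Injective f) (hfg : Function.Exact f g) (hgh : Function.Exact g h)
    (hh : Function.Surjective h) (hr : ¬ ∃ r : P₁ →ₗ[R] P₂, r ∘ₗ f = LinearMap.id) :
    pd (ModuleCat.of R M) = 2 := by
  refine le_antisymm (sInf_le ⟨2, rfl, pdLE_two_of_exact hf hfg hgh hh⟩) (le_sInf ?_)
  rintro _ ⟨k, rfl, hk⟩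
  by_contra! hlt
  have : k < 2 := by exact_mod_cast hlt
  exact hr (exists_leftInverse_of_pdLE hf hfg hgh hh (by lia) hk)

end ProjectiveDimension

theorem MvPolynomial.IsHomogeneous.constantCoeff_eq_zero {σ R : Type*} [CommSemiring R]
    {p : MvPolynomial σ R} {d : ℕ} (hp : p.IsHomogeneous d) (hd : d ≠ 0) : constantCoeff p = 0 :=
  hp.coeff_eq_zero (by simpa using hd.symm)

theorem MvPolynomial.not_exists_leftInverse {σ R ι : Type*} [CommRing R] [Nontrivial R] [Finite ι]
    {f : MvPolynomial σ R →ₗ[MvPolynomial σ R] (ι → MvPolynomial σ R)}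
    (hf : ∀ i, constantCoeff (f 1 i) = 0) :
    ¬ ∃ r : (ι → MvPolynomial σ R) →ₗ[MvPolynomial σ R] MvPolynomial σ R,
      r ∘ₗ f = LinearMap.id := by
  classical
  rintro ⟨r, hr⟩
  have := Fintype.ofFinite ι
  have h1 : r (f 1) = 1 := LinearMap.congr_fun hr 1
  rw [← Finset.univ_sum_single (f 1), map_sum] at h1
  have h2 (i : ι) : constantCoeff (r (Pi.single i (f 1 i))) = 0 := by
    rw [← mul_one (f 1 i), ← smul_eq_mul, Pi.single_smul, map_smul, smul_eq_mul, map_mul, hf,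
      zero_mul]
  simpa [h2] using congrArg constantCoeff h1

/-- The identification of the index set of the generators of the logarithmic derivations. -/
def genIndexEquiv (n : ℕ) : Fin n ⊕ Fin (n + 2) ≃ Fin (2 * (n + 2) - 2) :=
  finSumFinEquiv.trans (finCongr (by lia))

theorem relMap_genIndexEquiv_symm_isHomogeneous {n : ℕ} (hn : 4 ≤ n)
    (i : Fin (2 * (n + 2) - 2)) (j : Fin (n + 1)) :
    (relMap (Pi.single j 1 : Fin (n + 1) → Spoly (n + 2))
      ((genIndexEquiv n).symm i)).IsHomogeneous ((n + 2 - 2) - gendeg (n + 2) i) := by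
  obtain ⟨x, rfl⟩ := (genIndexEquiv n).surjective i
  rw [Equiv.symm_apply_apply]
  cases x with
  | inl k =>
    have : gendeg (n + 2) (genIndexEquiv n (.inl k)) = k := by
      simp only [gendeg, genIndexEquiv, Equiv.trans_apply, finSumFinEquiv_apply_left,
        finCongr_apply, Fin.val_cast, Fin.val_castAdd]
      lia
    rw [this]
    exact relMap_single_inl_isHomogeneous j k
  | inr v =>
    have : gendeg (n + 2) (genIndexEquiv n (.inr v)) = n - 1 := by
      simp only [gendeg, genIndexEquiv, Equiv.trans_apply, finSumFinEquiv_apply_right,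
        finCongr_apply, Fin.val_cast, Fin.val_natAdd]
      lia
    rw [this, show n + 2 - 2 - (n - 1) = 1 by lia]
    exact relMap_single_inr_isHomogeneous j v

theorem gendeg_lt {ℓ : ℕ} (hℓ : 6 ≤ ℓ) (i : Fin (2 * ℓ - 2)) : gendeg ℓ i < ℓ - 2 := by
  unfold gendeg
  lia

/-- For `ℓ ≥ 6` the module `D(A(C_ℓ^C))` of the `ℓ`-antihole has a minimal graded free
resolution `0 → S(-ℓ+1) → S(-ℓ+2)^{ℓ-1} → (⊕_{i=0}^{ℓ-4} S(-i)) ⊕ S(-ℓ+3)^{ℓ+1} →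
D(A(C_ℓ^C)) → 0`: there is an exact sequence
`0 → S → S^{ℓ-1} → S^{2ℓ-2} → D(A(C_ℓ^C)) → 0` in which the entries of the matrices of
the maps between the free modules are homogeneous of the degrees prescribed by the
twists (in particular of positive degree, i.e. with vanishing constant coefficient);
moreover `pd D(A(C_ℓ^C)) = 2`. -/
theorem antihole_minimal_free_resolution (ℓ : ℕ) (hℓ : 6 ≤ ℓ) :
    (∃ (f : Spoly ℓ →ₗ[Spoly ℓ] (Fin (ℓ - 1) → Spoly ℓ))
       (g : (Fin (ℓ - 1) → Spoly ℓ) →ₗ[Spoly ℓ] (Fin (2 * ℓ - 2) → Spoly ℓ))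
       (h : (Fin (2 * ℓ - 2) → Spoly ℓ) →ₗ[Spoly ℓ]
          (logDer ℓ ((SimpleGraph.cycleGraph ℓ)ᶜ))),
      Function.Injective f ∧
      LinearMap.range f = LinearMap.ker g ∧
      LinearMap.range g = LinearMap.ker h ∧
      Function.Surjective h ∧
      (∀ i : Fin (ℓ - 1), (f 1 i).IsHomogeneous 1) ∧
      (∀ (i : Fin (2 * ℓ - 2)) (j : Fin (ℓ - 1)),
        (g (Pi.single j 1) i).IsHomogeneous ((ℓ - 2) - gendeg ℓ i)) ∧
      (∀ i : Fin (ℓ - 1), constantCoeff (f 1 i) = 0) ∧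
      (∀ (i : Fin (2 * ℓ - 2)) (j : Fin (ℓ - 1)),
        constantCoeff (g (Pi.single j 1) i) = 0)) ∧
    pd (ModuleCat.of (Spoly ℓ) (logDer ℓ ((SimpleGraph.cycleGraph ℓ)ᶜ))) = 2 := by
  obtain ⟨n, rfl⟩ : ∃ n, ℓ = n + 2 := ⟨ℓ - 2, by lia⟩
  have hn : 3 ≤ n := by lia
  let e := LinearEquiv.funCongrLeft (Spoly (n + 2)) (Spoly (n + 2)) (genIndexEquiv n)
  have hfg : Function.Exact edgeMap (e.symm.toLinearMap ∘ₗ relMap (n := n)) := by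
    rw [LinearMap.exact_iff, LinearEquiv.ker_comp, range_edgeMap (by lia)]
  have hgh : Function.Exact (e.symm.toLinearMap ∘ₗ relMap (n := n))
      (genMap ∘ₗ e.toLinearMap) := by
    rw [LinearMap.exact_iff, LinearMap.ker_comp, LinearMap.range_comp, ker_genMap,
      range_relMap hn, Submodule.map_equiv_eq_comap_symm, LinearEquiv.symm_symm]
  have hh : Function.Surjective (genMap ∘ₗ e.toLinearMap) :=
    (genMap_surjective hn).comp e.surjective
  have hf₀ (i : Fin (n + 1)) : constantCoeff (edgeMap (n := n) 1 i) = 0 :=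
    (edgeMap_one_isHomogeneous i).constantCoeff_eq_zero one_ne_zero
  have hg := relMap_genIndexEquiv_symm_isHomogeneous (n := n) (by lia)
  exact ⟨⟨edgeMap, e.symm.toLinearMap ∘ₗ relMap, genMap ∘ₗ e.toLinearMap, edgeMap_injective,
    hfg.linearMap_ker_eq.symm, hgh.linearMap_ker_eq.symm, hh, edgeMap_one_isHomogeneous, hg, hf₀,
    fun i j ↦ (hg i j).constantCoeff_eq_zero (Nat.sub_pos_of_lt (gendeg_lt hℓ i)).ne'⟩,
    pd_eq_two_of_exact edgeMap_injective hfg hgh hh (MvPolynomial.not_exists_leftInverse hf₀)⟩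
end

section
/- Let G = (V,E) be a finite weakly chordal simple graph. Then there exists a sequence of edges e_1,…,e_k ∉ E such that: (1) the graph G_i = (V, E ∪ {e_1,…,e_i}) is weakly chordal for i = 1,…,k−1; (2) for each i = 1,…,k, the edge e_i is not an edge of any induced 4-cycle of G_i; and (3) the graph G_k is chordal. -/
open MvPolynomial CategoryTheory

/-- `G` contains an induced cycle of length `n`, i.e. an induced subgraph
isomorphic to the cycle graph on `n` vertices. -/
def HasInducedCycleLen {V : Type} (G : SimpleGraph V) (n : ℕ) : Prop :=
  ∃ s : Set V, Nonempty (G.induce s ≃g SimpleGraph.cycleGraph n)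

/-- A graph is chordal if it has no induced cycle of length at least 4. -/
def Chordal {V : Type} (G : SimpleGraph V) : Prop :=
  ∀ n : ℕ, 4 ≤ n → ¬ HasInducedCycleLen G n

/-- A graph is weakly chordal if neither it nor its complement contains an
induced cycle of length at least 5. -/
def WeaklyChordal {V : Type} (G : SimpleGraph V) : Prop :=
  (∀ n : ℕ, 5 ≤ n → ¬ HasInducedCycleLen G n) ∧
  (∀ n : ℕ, 5 ≤ n → ¬ HasInducedCycleLen Gᶜ n)

/-- The graph obtained from `G` by adding the first `m` edges of the sequence `e`. -/
def addEdges {V : Type} (G : SimpleGraph V) {k : ℕ} (e : Fin k → Sym2 V) (m : ℕ) :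
    SimpleGraph V :=
  SimpleGraph.fromEdgeSet (G.edgeSet ∪ e '' {j | (j : ℕ) < m})


/-- The vertices `p 0, …, p m` form an induced path of `G`, in this order. -/
def IsInducedPath {V : Type} (G : SimpleGraph V) (p : ℕ → V) (m : ℕ) : Prop :=
  ∀ i j, i < j → j ≤ m → p i ≠ p j ∧ (G.Adj (p i) (p j) ↔ j = i + 1)

/-- The vertices `p 0, …, p (n - 1)` form an induced cycle of `G`, in this cyclic order. -/
def IsInducedCycle {V : Type} (G : SimpleGraph V) (p : ℕ → V) (n : ℕ) : Prop :=
  ∀ i j, i < j → j < n → p i ≠ p j ∧ (G.Adj (p i) (p j) ↔ j = i + 1 ∨ i = 0 ∧ j + 1 = n)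

lemma cycleGraph_adj_iff_of_lt {n : ℕ} (hn : 3 ≤ n) {i j : Fin n} (hij : i < j) :
    (SimpleGraph.cycleGraph n).Adj i j ↔ (j : ℕ) = i + 1 ∨ (i : ℕ) = 0 ∧ (j : ℕ) + 1 = n := by
  obtain ⟨n, rfl⟩ : ∃ k, n = k + 2 := ⟨n - 2, by omega⟩
  have hij' : (i : ℕ) < j := hij
  have h1 : ((i - j : Fin (n + 2)) : ℕ) = n + 2 - j + i := by
    rw [Fin.sub_def]; exact Nat.mod_eq_of_lt (by omega)
  have h2 : ((j - i : Fin (n + 2)) : ℕ) = j - i := by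
    rw [Fin.sub_def]
    change (n + 2 - (i : ℕ) + j) % (n + 2) = _
    rw [show n + 2 - (i : ℕ) + j = (j - i) + (n + 2) by omega, Nat.add_mod_right]
    exact Nat.mod_eq_of_lt (by omega)
  rw [SimpleGraph.cycleGraph_adj', h1, h2]
  omega

lemma exists_isInducedCycle_of_iso {V : Type} {G : SimpleGraph V} {n : ℕ} (hn : 3 ≤ n) {s : Set V}
    (hs : Nonempty (G.induce s ≃g SimpleGraph.cycleGraph n)) :
    ∃ p, IsInducedCycle G p n ∧ ∀ v ∈ s, ∃ i < n, p i = v := by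
  obtain ⟨φ⟩ := hs
  refine ⟨fun i => if h : i < n then φ.symm ⟨i, h⟩ else φ.symm ⟨0, by omega⟩, ?_, ?_⟩
  · intro i j hij hj
    have hi : i < n := by omega
    simp only [hi, hj, dif_pos]
    constructor
    · intro h
      have := φ.symm.injective (Subtype.ext h)
      simp at this
      omega
    · have := cycleGraph_adj_iff_of_lt hn (i := ⟨i, hi⟩) (j := ⟨j, hj⟩) hij
      rw [← φ.symm.map_adj_iff] at this
      simpa using this
  · intro v hv
    exact ⟨φ ⟨v, hv⟩, (φ ⟨v, hv⟩).2, by simp⟩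

lemma hasInducedCycleLen_iff {V : Type} {G : SimpleGraph V} {n : ℕ} (hn : 3 ≤ n) :
    HasInducedCycleLen G n ↔ ∃ p, IsInducedCycle G p n := by
  constructor
  · rintro ⟨s, hs⟩
    obtain ⟨p, hp, -⟩ := exists_isInducedCycle_of_iso hn hs
    exact ⟨p, hp⟩
  · rintro ⟨p, hp⟩
    have hadj (i j : Fin n) : G.Adj (p i) (p j) ↔ (SimpleGraph.cycleGraph n).Adj i j := by
      rcases lt_trichotomy i j with h | rfl | h
      · rw [cycleGraph_adj_iff_of_lt hn h]; exact (hp i j h j.2).2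
      · simp
      · rw [SimpleGraph.adj_comm, SimpleGraph.adj_comm _ i, cycleGraph_adj_iff_of_lt hn h]
        exact (hp j i h i.2).2
    have hinj : Function.Injective fun i : Fin n => p i := by
      intro i j h
      rcases lt_trichotomy i j with h' | h' | h'
      · exact absurd h (hp i j h' j.2).1
      · exact h'
      · exact absurd h.symm (hp j i h' i.2).1
    refine ⟨Set.range fun i : Fin n => p i, ⟨SimpleGraph.Iso.symm ⟨Equiv.ofInjective _ hinj, ?_⟩⟩⟩
    intro i j
    simpa using hadj i j

lemma WeaklyChordal.not_isInducedCycle {V : Type} {G : SimpleGraph V} (hG : WeaklyChordal G)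
    {p : ℕ → V} {n : ℕ} (hn : 5 ≤ n) : ¬ IsInducedCycle G p n :=
  fun h => hG.1 n hn ((hasInducedCycleLen_iff (by omega)).2 ⟨p, h⟩)

lemma WeaklyChordal.not_isInducedCycle_compl {V : Type} {G : SimpleGraph V}
    (hG : WeaklyChordal G) {p : ℕ → V} {n : ℕ} (hn : 5 ≤ n) : ¬ IsInducedCycle Gᶜ p n :=
  fun h => hG.2 n hn ((hasInducedCycleLen_iff (by omega)).2 ⟨p, h⟩)

lemma IsInducedPath.subpath {V : Type} {G : SimpleGraph V} {p : ℕ → V} {m : ℕ}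
    (hp : IsInducedPath G p m) {a l : ℕ} (h : a + l ≤ m) :
    IsInducedPath G (fun i => p (a + i)) l := fun i j hij hj => by
  have := hp (a + i) (a + j) (by omega) (by omega)
  exact ⟨this.1, this.2.trans (by omega)⟩

lemma IsInducedPath.reverse {V : Type} {G : SimpleGraph V} {p : ℕ → V} {m : ℕ}
    (hp : IsInducedPath G p m) : IsInducedPath G (fun i => p (m - i)) m := fun i j hij hj => by
  have := hp (m - j) (m - i) (by omega) (by omega)
  exact ⟨this.1.symm, (SimpleGraph.adj_comm _ _ _).trans (this.2.trans (by omega))⟩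

lemma IsInducedPath.append {V : Type} {G : SimpleGraph V} {p : ℕ → V} {m : ℕ}
    (hp : IsInducedPath G p m) {v : V} (hne : ∀ i ≤ m, p i ≠ v)
    (hv : ∀ i ≤ m, G.Adj (p i) v ↔ i = m) :
    IsInducedPath G (fun i => if i ≤ m then p i else v) (m + 1) := fun i j hij hj => by
  have hi : i ≤ m := by omega
  by_cases hjm : j ≤ m
  · simpa [hi, hjm] using hp i j hij hjm
  · simp only [hi, hjm, if_true, if_false]
    exact ⟨hne i hi, (hv i hi).trans (by omega)⟩

lemma IsInducedPath.prepend {V : Type} {G : SimpleGraph V} {p : ℕ → V} {m : ℕ}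
    (hp : IsInducedPath G p m) {v : V} (hne : ∀ i ≤ m, p i ≠ v)
    (hv : ∀ i ≤ m, G.Adj (p i) v ↔ i = 0) :
    IsInducedPath G (fun i => if i = 0 then v else p (i - 1)) (m + 1) := fun i j hij hj => by
  have hj0 : j ≠ 0 := by omega
  by_cases hi : i = 0
  · simp only [hi, hj0, if_true, if_false]
    exact ⟨(hne _ (by omega)).symm,
      (SimpleGraph.adj_comm _ _ _).trans ((hv _ (by omega)).trans (by omega))⟩
  · simp only [hi, hj0, if_false]
    have := hp (i - 1) (j - 1) (by omega) (by omega)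
    exact ⟨this.1, this.2.trans (by omega)⟩

lemma IsInducedPath.isInducedCycle {V : Type} {G : SimpleGraph V} {p : ℕ → V} {m : ℕ}
    (hp : IsInducedPath G p m) {v : V} (hne : ∀ i ≤ m, p i ≠ v)
    (hv : ∀ i ≤ m, G.Adj (p i) v ↔ i = 0 ∨ i = m) :
    IsInducedCycle G (fun i => if i ≤ m then p i else v) (m + 2) := fun i j hij hj => by
  have hi : i ≤ m := by omega
  by_cases hjm : j ≤ m
  · simp only [hi, hjm, if_true]
    exact ⟨(hp i j hij hjm).1, (hp i j hij hjm).2.trans (by omega)⟩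
  · simp only [hi, hjm, if_true, if_false]
    exact ⟨hne i hi, (hv i hi).trans (by omega)⟩

lemma IsInducedCycle.rotate {V : Type} {G : SimpleGraph V} {p : ℕ → V} {n : ℕ}
    (hp : IsInducedCycle G p n) {k : ℕ} (hk : k < n) :
    IsInducedCycle G (fun i => if i + k < n then p (i + k) else p (i + k - n)) n := by
  intro i j hij hj
  by_cases hj' : j + k < n
  · have hi' : i + k < n := by omega
    simp only [hi', hj', if_true]
    have := hp (i + k) (j + k) (by omega) hj'
    exact ⟨this.1, this.2.trans (by omega)⟩
  · by_cases hi' : i + k < n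
    · simp only [hi', hj', if_true, if_false]
      have := hp (j + k - n) (i + k) (by omega) (by omega)
      exact ⟨this.1.symm, (SimpleGraph.adj_comm _ _ _).trans (this.2.trans (by omega))⟩
    · simp only [hi', hj', if_false]
      have := hp (i + k - n) (j + k - n) (by omega) (by omega)
      exact ⟨this.1, this.2.trans (by omega)⟩

/-- In a connected induced subgraph, two nonempty disjoint vertex sets are joined by an induced
path that meets each of them in one end only. -/
lemma exists_isInducedPath_between {V : Type} {H : SimpleGraph V} {C A B : Set V}
    (hC : (H.induce C).Connected) (hA : ∃ a ∈ A, a ∈ C) (hB : ∃ b ∈ B, b ∈ C) :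
    ∃ (q : ℕ → V) (r : ℕ), IsInducedPath H q r ∧ (∀ i ≤ r, q i ∈ C) ∧
      (∀ i ≤ r, q i ∈ A ↔ i = 0) ∧ (∀ i ≤ r, q i ∈ B ↔ i = r) := by
  classical
  let P : ℕ → Prop := fun r => ∃ q : ℕ → V, (∀ i ≤ r, q i ∈ C) ∧ q 0 ∈ A ∧ q r ∈ B ∧
    ∀ i < r, H.Adj (q i) (q (i + 1))
  have hex : ∃ r, P r := by
    obtain ⟨a, haA, haC⟩ := hA
    obtain ⟨b, hbB, hbC⟩ := hB
    obtain ⟨w⟩ := hC.preconnected ⟨a, haC⟩ ⟨b, hbC⟩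
    refine ⟨w.length, fun i => w.getVert i, fun i _ => (w.getVert i).2, by simpa, by simpa, ?_⟩
    intro i hi
    simpa using w.adj_getVert_succ hi
  obtain ⟨q, hqC, hqA, hqB, hq⟩ := Nat.find_spec hex
  have hmin : ∀ k, P k → Nat.find hex ≤ k := fun k hk => Nat.find_min' hex hk
  set r := Nat.find hex with hr
  -- the walk cannot be shortened by jumping from `q i` to `q j`
  have jump (i j : ℕ) (hij : i + 1 < j) (hj : j ≤ r) : ¬ H.Adj (q i) (q j) := by
    intro hadj
    have := hmin (r - (j - i - 1))
      ⟨fun k => if k ≤ i then q k else q (k + (j - i - 1)), ?_, ?_, ?_, ?_⟩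
    · omega
    · intro k hk
      dsimp only
      split_ifs <;> exact hqC _ (by omega)
    · simpa using hqA
    · have h1 : ¬ r - (j - i - 1) ≤ i := by omega
      have h2 : r - (j - i - 1) + (j - i - 1) = r := by omega
      simpa only [h1, if_false, h2] using hqB
    · intro k hk
      dsimp only
      rcases lt_trichotomy k i with h | h | h
      · simpa [h.le, Nat.succ_le_of_lt h] using hq k (by omega)
      · subst h
        have : k + 1 + (j - k - 1) = j := by omega
        simpa [this] using hadj
      · have h1 : ¬ k ≤ i := by omega
        have h2 : ¬ k + 1 ≤ i := by omega
        have h3 : k + 1 + (j - i - 1) = k + (j - i - 1) + 1 := by omega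
        simp only [h1, h2, if_false, h3]
        exact hq _ (by omega)
  have hA0 (i : ℕ) (hi : i ≤ r) (h : q i ∈ A) : i = 0 := by
    have := hmin (r - i) ⟨fun k => q (k + i), fun k hk => hqC _ (by omega), by simpa, ?_, ?_⟩
    · omega
    · simpa [show r - i + i = r by omega] using hqB
    · intro k hk
      have := hq (k + i) (by omega)
      simpa [show k + i + 1 = k + 1 + i by omega] using this
  have hBr (i : ℕ) (hi : i ≤ r) (h : q i ∈ B) : i = r := by
    have := hmin i ⟨q, fun k hk => hqC _ (by omega), hqA, h, fun k hk => hq k (by omega)⟩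
    omega
  refine ⟨q, r, ?_, hqC, fun i hi => ⟨hA0 i hi, fun h => h ▸ hqA⟩,
    fun i hi => ⟨hBr i hi, fun h => h ▸ hqB⟩⟩
  intro i j hij hj
  refine ⟨fun heq => ?_, fun hadj => ?_, fun h => h ▸ hq i (by omega)⟩
  · rcases Nat.eq_zero_or_pos i with rfl | hi
    · have := hA0 j hj (heq ▸ hqA)
      omega
    · obtain ⟨k, rfl⟩ : ∃ k, i = k + 1 := ⟨i - 1, by omega⟩
      exact jump k j (by omega) hj (heq ▸ hq k (by omega))
  · by_contra hne
    exact jump i j (by omega) hj hadj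

/-- In a weakly chordal graph, a vertex adjacent to both ends of an induced path of length at
least 3 is adjacent to one of the first two interior vertices of the path. -/
lemma WeaklyChordal.adj_one_or_adj_two {V : Type} {G : SimpleGraph V} (hG : WeaklyChordal G)
    {p : ℕ → V} {m : ℕ} (hp : IsInducedPath G p m) (hm : 3 ≤ m) {c : V}
    (hne : ∀ i ≤ m, p i ≠ c) (h0 : G.Adj c (p 0)) (hend : G.Adj c (p m)) :
    G.Adj c (p 1) ∨ G.Adj c (p 2) := by
  classical
  by_contra! h
  have hex : ∃ b, 0 < b ∧ G.Adj c (p b) := ⟨m, by omega, hend⟩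
  obtain ⟨hb0, hb⟩ := Nat.find_spec hex
  have hbm : Nat.find hex ≤ m := Nat.find_min' hex ⟨by omega, hend⟩
  have hlt (i : ℕ) (hi : i < Nat.find hex) (hi0 : 0 < i) : ¬ G.Adj c (p i) :=
    fun hadj => Nat.find_min hex hi ⟨hi0, hadj⟩
  set b := Nat.find hex
  have hb1 : b ≠ 1 := fun e => h.1 (e ▸ hb)
  have hb2 : b ≠ 2 := fun e => h.2 (e ▸ hb)
  have hsub : IsInducedPath G p b := fun i j hij hj => hp i j hij (by omega)
  refine hG.not_isInducedCycle (by omega)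
    (hsub.isInducedCycle (v := c) (fun i hi => hne i (by omega)) fun i hi => ?_)
  rw [SimpleGraph.adj_comm]
  constructor
  · intro hadj
    by_contra! hi'
    exact hlt i (by omega) (by omega) hadj
  · rintro (rfl | rfl)
    exacts [h0, hb]

/-- If every vertex of a co-connected set `C` is adjacent to both ends of an induced path of
length at least 3 in a weakly chordal graph, then some interior vertex of the path is adjacent to
every vertex of `C`. -/
lemma WeaklyChordal.exists_interior_complete {V : Type} {G : SimpleGraph V}
    (hG : WeaklyChordal G) {p : ℕ → V} {m : ℕ} (hp : IsInducedPath G p m) (hm : 3 ≤ m)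
    {C : Set V} (hC : (Gᶜ.induce C).Connected) (h0 : ∀ c ∈ C, G.Adj c (p 0))
    (hend : ∀ c ∈ C, G.Adj c (p m)) :
    ∃ i, 0 < i ∧ i < m ∧ ∀ c ∈ C, G.Adj c (p i) := by
  by_contra! hcon
  have hne : ∀ c ∈ C, ∀ i ≤ m, p i ≠ c := by
    rintro c hc i hi rfl
    have h1 := h0 _ hc
    have h2 := hend _ hc
    rcases Nat.eq_zero_or_pos i with rfl | hi0
    · exact h1.ne rfl
    rcases hi.lt_or_eq with hi' | rfl
    · have e1 := (hp 0 i hi0 hi).2.1 h1.symm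
      have e2 := (hp i m hi' le_rfl).2.1 h2
      omega
    · exact h2.ne rfl
  obtain ⟨c₁, hc₁, hn₁⟩ := hcon 1 (by omega) (by omega)
  obtain ⟨c₂, hc₂, hn₂⟩ := hcon 2 (by omega) (by omega)
  obtain ⟨q, r, hq, hqC, hqA, hqB⟩ := exists_isInducedPath_between
    (A := {c | ¬ G.Adj c (p 1)}) (B := {c | ¬ G.Adj c (p 2)}) hC ⟨c₁, hn₁, hc₁⟩ ⟨c₂, hn₂, hc₂⟩
  simp only [Set.mem_ofPred_eq] at hqA hqB
  have hr : 0 < r := by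
    rcases Nat.eq_zero_or_pos r with rfl | h
    · have hq0 := hqC 0 le_rfl
      rcases hG.adj_one_or_adj_two hp hm (hne _ hq0) (h0 _ hq0) (hend _ hq0) with h | h
      · exact absurd h ((hqA 0 le_rfl).2 rfl)
      · exact absurd h ((hqB 0 le_rfl).2 rfl)
    · exact h
  have hqne (i : ℕ) (hi : i ≤ r) (j : ℕ) (hj : j ≤ m) : q i ≠ p j := (hne _ (hqC i hi) j hj).symm
  have hq0 (i : ℕ) (hi : i ≤ r) : G.Adj (q i) (p 0) := h0 _ (hqC i hi)
  have hqm (i : ℕ) (hi : i ≤ r) : G.Adj (q i) (p m) := hend _ (hqC i hi)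
  have p12 := hp 1 2 (by omega) (by omega)
  have p01 := hp 0 1 (by omega) (by omega)
  have p02 := hp 0 2 (by omega) (by omega)
  have p0m := hp 0 m (by omega) (by omega)
  have p1m := hp 1 m (by omega) (by omega)
  have p2m := hp 2 m (by omega) (by omega)
  have t₁ := hq.append (v := p 2) (fun i hi => hqne i hi 2 (by omega)) fun i hi => by
    rw [SimpleGraph.compl_adj, hqB i hi]
    exact and_iff_right (hqne i hi 2 (by omega))
  have t₂ := t₁.prepend (v := p 1)
    (fun i hi => by
      split_ifs with h
      exacts [hqne i h 1 (by omega), p12.1.symm])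
    (fun i hi => by
      rw [SimpleGraph.compl_adj]
      split_ifs with h
      · rw [hqA i h]
        exact and_iff_right (hqne i h 1 (by omega))
      · have := p12.2.2 rfl
        exact iff_of_false (fun h' => h'.2 this.symm) (by omega))
  rcases hm.eq_or_lt with rfl | hm4
  · have t₃ := t₂.append (v := p 0)
      (fun i hi => by
        split_ifs with h h'
        exacts [p01.1.symm, hqne _ h' 0 (by omega), p02.1.symm])
      (fun i hi => by
        rw [SimpleGraph.compl_adj, SimpleGraph.adj_comm]
        split_ifs with h h'
        · exact iff_of_false (fun h' => h'.2 (p01.2.2 rfl)) (by omega)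
        · exact iff_of_false (fun h'' => h''.2 (hq0 _ h').symm) (by omega)
        · exact iff_of_true ⟨p02.1.symm, fun h => by have := p02.2.1 h; omega⟩ (by omega))
    refine hG.not_isInducedCycle_compl (by omega) (t₃.isInducedCycle (v := p 3)
      (fun i hi => ?_) fun i hi => ?_)
    · split_ifs with h₁ h₂ h₃
      exacts [p1m.1, hqne _ h₃ 3 le_rfl, p2m.1, p0m.1]
    · rw [SimpleGraph.compl_adj]
      split_ifs with h₁ h₂ h₃
      · exact iff_of_true ⟨p1m.1, fun h => by have := p1m.2.1 h; omega⟩ (by omega)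
      · exact iff_of_false (fun h => h.2 (hqm _ h₃)) (by omega)
      · exact iff_of_false (fun h => h.2 (p2m.2.2 rfl)) (by omega)
      · exact iff_of_true ⟨p0m.1, fun h => by have := p0m.2.1 h; omega⟩ (by omega)
  · refine hG.not_isInducedCycle_compl (by omega) (t₂.isInducedCycle (v := p m)
      (fun i hi => ?_) fun i hi => ?_)
    · split_ifs with h₂ h₃
      exacts [p1m.1, hqne _ h₃ m le_rfl, p2m.1]
    · rw [SimpleGraph.compl_adj]
      split_ifs with h₂ h₃
      · exact iff_of_true ⟨p1m.1, fun h => by have := p1m.2.1 h; omega⟩ (by omega)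
      · exact iff_of_false (fun h => h.2 (hqm _ h₃)) (by omega)
      · exact iff_of_true ⟨p2m.1, fun h => by have := p2m.2.1 h; omega⟩ (by omega)

/-- Two distinct nonadjacent vertices `x` and `y` form a two-pair of the subgraph induced by `S`
if every induced path between them inside `S` has length (at most) 2. -/
structure IsTwoPairOn {V : Type} (G : SimpleGraph V) (S : Set V) (x y : V) : Prop where
  ne : x ≠ y
  not_adj : ¬ G.Adj x y
  length_le_two : ∀ (p : ℕ → V) (m : ℕ), IsInducedPath G p m → (∀ i ≤ m, p i ∈ S) →
    p 0 = x → p m = y → m ≤ 2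

/-- The inductive step in the existence of two-pairs: a two-pair among the common neighbours of a
maximal co-connected set whose common neighbours do not form a clique is a two-pair. -/
lemma WeaklyChordal.isTwoPairOn_of_maximal {V : Type} {G : SimpleGraph V} (hG : WeaklyChordal G)
    {S C : Set V} (hC : (Gᶜ.induce C).Connected)
    (hmax : ∀ w ∈ S, w ∉ C → (∃ c ∈ C, ¬ G.Adj c w) →
      G.IsClique {v ∈ S | ∀ c ∈ insert w C, G.Adj c v})
    {x y : V} (hx : x ∈ {v ∈ S | ∀ c ∈ C, G.Adj c v}) (hy : y ∈ {v ∈ S | ∀ c ∈ C, G.Adj c v})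
    (hxy : IsTwoPairOn G {v ∈ S | ∀ c ∈ C, G.Adj c v} x y) : IsTwoPairOn G S x y := by
  classical
  refine ⟨hxy.ne, hxy.not_adj, fun p m hp hpS hp0 hpm => ?_⟩
  subst hp0 hpm
  by_contra! hm
  by_cases hall : ∀ i ≤ m, p i ∈ {v ∈ S | ∀ c ∈ C, G.Adj c v}
  · have := hxy.length_le_two p m hp hall rfl rfl
    omega
  set M := {v ∈ S | ∀ c ∈ C, G.Adj c v} with hM
  push Not at hall
  obtain ⟨him, hiM⟩ := Nat.find_spec hall
  have hlt (k : ℕ) (hk : k < Nat.find hall) : p k ∈ M := by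
    by_contra h
    exact Nat.find_min hall hk ⟨by omega, h⟩
  set i := Nat.find hall
  have hi0 : i ≠ 0 := fun e => hiM (e ▸ hx)
  have hexj : ∃ j, i < j ∧ p j ∈ M :=
    ⟨m, lt_of_le_of_ne him fun e => hiM (e ▸ hy), hy⟩
  obtain ⟨hij, hjM⟩ := Nat.find_spec hexj
  have hjm : Nat.find hexj ≤ m :=
    Nat.find_min' hexj ⟨lt_of_le_of_ne him fun e => hiM (e ▸ hy), hy⟩
  have hbetween (k : ℕ) (hk : k < Nat.find hexj) (hik : i ≤ k) : p k ∉ M := by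
    rcases hik.eq_or_lt with rfl | h
    · exact hiM
    · exact fun h' => Nat.find_min hexj hk ⟨h, h'⟩
  set j := Nat.find hexj
  obtain ⟨a, ha⟩ : ∃ a, i = a + 1 := ⟨i - 1, by omega⟩
  have haM : p a ∈ M := hlt a (by omega)
  by_cases hj3 : j = a + 2
  · have hadj₁ : G.Adj (p i) (p a) := ((hp a i (by omega) (by omega)).2.2 ha).symm
    have hadj₂ : G.Adj (p i) (p j) := (hp i j hij hjm).2.2 (by omega)
    have hiC : p i ∉ C := fun h => by
      have h₁ := hx.2 _ h
      have h₂ := hy.2 _ h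
      have him' : i < m := by omega
      have e₁ := (hp 0 i (by omega) (by omega)).2.1 h₁.symm
      have e₂ := (hp i m him' le_rfl).2.1 h₂
      omega
    have hnc : ∃ c ∈ C, ¬ G.Adj c (p i) := by
      by_contra! h
      exact hiM ⟨hpS i him, h⟩
    have hcl := hmax (p i) (hpS i him) hiC hnc
    have haj := hp a j (by omega) hjm
    have := hcl (x := p a) ⟨haM.1, by rintro c (rfl | hc); exacts [hadj₁, haM.2 c hc]⟩
      (y := p j) ⟨hjM.1, by rintro c (rfl | hc); exacts [hadj₂, hjM.2 c hc]⟩ haj.1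
    have := haj.2.1 this
    omega
  · obtain ⟨k, hk0, hk, hkC⟩ := hG.exists_interior_complete
      (hp.subpath (a := a) (l := j - a) (by omega)) (by omega) hC haM.2
      (by simpa [show a + (j - a) = j by omega] using hjM.2)
    exact hbetween (a + k) (by omega) (by omega) ⟨hpS _ (by omega), hkC⟩

/-- A set of vertices of a weakly chordal graph that is not a clique contains a two-pair. -/
lemma WeaklyChordal.exists_isTwoPairOn {V : Type} [Finite V] {G : SimpleGraph V}
    (hG : WeaklyChordal G) (S : Set V) (hS : ¬ G.IsClique S) :
    ∃ x ∈ S, ∃ y ∈ S, IsTwoPairOn G S x y := by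
  induction hn : S.ncard using Nat.strong_induction_on generalizing S with
  | _ n ih =>
  let Q : Set V → Prop := fun C => C ⊆ S ∧ (Gᶜ.induce C).Connected ∧
    ¬ G.IsClique {v ∈ S | ∀ c ∈ C, G.Adj c v}
  by_cases hQ : ∃ C, Q C
  · obtain ⟨C₀, hC₀⟩ := hQ
    obtain ⟨C, -, hCmax⟩ := Finite.exists_le_maximal hC₀
    obtain ⟨hCS, hCconn, hCcl⟩ := hCmax.prop
    obtain ⟨⟨c, hc⟩⟩ := hCconn.nonempty
    have hlt : {v ∈ S | ∀ c ∈ C, G.Adj c v}.ncard < n := by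
      rw [← hn]
      refine Set.ncard_lt_ncard ⟨Set.sep_subset _ _, fun h => ?_⟩ (Set.toFinite _)
      exact ((h (hCS hc)).2 c hc).ne rfl
    obtain ⟨x, hx, y, hy, hxy⟩ := ih _ hlt _ hCcl rfl
    refine ⟨x, hx.1, y, hy.1, hG.isTwoPairOn_of_maximal hCconn ?_ hx hy hxy⟩
    rintro w hwS hwC ⟨c, hc, hcw⟩
    by_contra hcl
    have hcw' : Gᶜ.Adj w c := (SimpleGraph.compl_adj _ _ _).2
      ⟨by rintro rfl; exact hwC hc, fun h => hcw h.symm⟩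
    have hconn : (Gᶜ.induce (insert w C)).Connected := by
      rw [Set.insert_eq]
      exact SimpleGraph.connected_induce_union .of_subsingleton hCconn.preconnected
        (Set.mem_singleton w) hc hcw'
    exact hwC (hCmax.le_of_ge ⟨Set.insert_subset hwS hCS, hconn, hcl⟩ (Set.subset_insert w C)
      (Set.mem_insert w C))
  · obtain ⟨x, hx, y, hy, hne, hxy⟩ : ∃ x ∈ S, ∃ y ∈ S, x ≠ y ∧ ¬ G.Adj x y := by
      by_contra! h
      exact hS fun x hx y hy hne => h x hx y hy hne
    refine ⟨x, hx, y, hy, hne, hxy, fun p m hp hpS hp0 hpm => ?_⟩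
    by_contra! hm
    refine hQ ⟨{p 1}, ?_, SimpleGraph.Connected.of_subsingleton, fun hcl => ?_⟩
    · simpa using hpS 1 (by omega)
    · have h02 := hp 0 2 (by omega) (by omega)
      have := hcl (x := p 0) ⟨hpS 0 (by omega), by
          simpa using ((hp 0 1 (by omega) (by omega)).2.2 rfl).symm⟩
        (y := p 2) ⟨hpS 2 (by omega), by simpa using (hp 1 2 (by omega) (by omega)).2.2 rfl⟩ h02.1
      have := h02.2.1 this
      omega

lemma IsTwoPairOn.symm {V : Type} {G : SimpleGraph V} {S : Set V} {x y : V}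
    (h : IsTwoPairOn G S x y) : IsTwoPairOn G S y x :=
  ⟨h.ne.symm, fun hadj => h.not_adj hadj.symm, fun p m hp hpS hp0 hpm =>
    h.length_le_two _ m hp.reverse (fun i _ => hpS _ (by omega)) (by simpa) (by simpa)⟩

lemma IsInducedCycle.injOn {V : Type} {G : SimpleGraph V} {p : ℕ → V} {n : ℕ}
    (hp : IsInducedCycle G p n) {i j : ℕ} (hi : i < n) (hj : j < n) (h : p i = p j) : i = j := by
  rcases lt_trichotomy i j with h' | h' | h'
  · exact absurd h (hp i j h' hj).1
  · exact h'
  · exact absurd h.symm (hp j i h' hi).1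

lemma IsInducedCycle.congr {V : Type} {G H : SimpleGraph V} {p : ℕ → V} {n : ℕ}
    (hp : IsInducedCycle G p n) (h : ∀ i < n, ∀ j < n, H.Adj (p i) (p j) ↔ G.Adj (p i) (p j)) :
    IsInducedCycle H p n := fun i j hij hj =>
  ⟨(hp i j hij hj).1, (h i (by omega) j hj).trans (hp i j hij hj).2⟩

lemma sup_edge_adj_iff {V : Type} {G : SimpleGraph V} {x y : V} (hxy : x ≠ y) (v w : V) :
    (G ⊔ SimpleGraph.edge x y).Adj v w ↔ G.Adj v w ∨ v = x ∧ w = y ∨ v = y ∧ w = x := by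
  rw [SimpleGraph.sup_adj, SimpleGraph.edge_adj]
  grind

/-- An edge added between the vertices of a two-pair lies on no induced cycle of length at
least 4. -/
lemma IsTwoPairOn.not_isInducedCycle_sup_edge {V : Type} {G : SimpleGraph V} {x y : V}
    (h : IsTwoPairOn G Set.univ x y) {p : ℕ → V} {n : ℕ} (hn : 4 ≤ n)
    (hp : IsInducedCycle (G ⊔ SimpleGraph.edge x y) p n) {a b : ℕ} (ha : a < n) (hb : b < n)
    (hax : p a = x) (hby : p b = y) : False := by
  wlog hab : a < b generalizing x y a b with H
  · have : a ≠ b := by rintro rfl; exact h.ne (hax ▸ hby)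
    exact H h.symm (SimpleGraph.edge_comm x y ▸ hp) hb ha hby hax (by omega)
  -- it remains to treat a cycle whose closing edge is the new edge
  have key : ∀ {x y : V} {p : ℕ → V}, IsTwoPairOn G Set.univ x y →
      IsInducedCycle (G ⊔ SimpleGraph.edge x y) p n → p 0 = x → p (n - 1) = y → False := by
    intro x y p h hp h0 h1
    have := h.length_le_two p (n - 1) (fun i j hij hj => ?_) (fun _ _ => Set.mem_univ _) h0 h1
    · omega
    · have hcyc := hp i j hij (by omega)
      refine ⟨hcyc.1, ?_⟩
      have hadj := hcyc.2
      rw [sup_edge_adj_iff h.ne] at hadj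
      have e₁ : p i = x → i = 0 := fun e => hp.injOn (by omega) (by omega) (e.trans h0.symm)
      have e₂ : p j = y → j = n - 1 := fun e => hp.injOn (by omega) (by omega) (e.trans h1.symm)
      have e₃ : p j = x → j = 0 := fun e => hp.injOn (by omega) (by omega) (e.trans h0.symm)
      constructor
      · intro hG
        rcases hadj.1 (Or.inl hG) with e | ⟨rfl, e⟩
        · exact e
        · obtain rfl : j = n - 1 := by omega
          exact absurd (h0 ▸ h1 ▸ hG) h.not_adj
      · rintro rfl
        rcases hadj.2 (Or.inl rfl) with e | e | e
        · exact e
        · have := e₁ e.1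
          have := e₂ e.2
          omega
        · have := e₃ e.2
          omega
  have hadj : (G ⊔ SimpleGraph.edge x y).Adj (p a) (p b) :=
    (sup_edge_adj_iff h.ne _ _).2 (Or.inr (Or.inl ⟨hax, hby⟩))
  rcases (hp a b hab hb).2.1 hadj with rfl | ⟨rfl, rfl⟩
  · refine key h.symm (SimpleGraph.edge_comm x y ▸ hp.rotate hb) ?_ ?_
    · simpa [hb] using hby
    · have e₁ : ¬ n - 1 + (a + 1) < n := by omega
      have e₂ : n - 1 + (a + 1) - n = a := by omega
      simpa only [e₁, if_false, e₂] using hax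
  · exact key h hp hax (by simpa using hby)

/-- A graph obtained by adding an edge between the vertices of a two-pair to a weakly chordal
graph is free of complements of long induced cycles through that edge. -/
lemma IsTwoPairOn.not_isInducedCycle_compl_sup_edge {V : Type} {G : SimpleGraph V}
    (hG : WeaklyChordal G) {x y : V} (h : IsTwoPairOn G Set.univ x y) {p : ℕ → V} {n : ℕ}
    (hn : 5 ≤ n) (hp : IsInducedCycle (G ⊔ SimpleGraph.edge x y)ᶜ p n) {b : ℕ} (hb : b < n)
    (hx : p 0 = x) (hy : p b = y) : False := by
  have hadj (i j : ℕ) (hij : i < j) (hj : j < n) :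
      Gᶜ.Adj (p i) (p j) ↔ (j = i + 1 ∨ i = 0 ∧ j + 1 = n) ∨ i = 0 ∧ j = b := by
    have hcyc := hp i j hij hj
    rw [← hcyc.2, SimpleGraph.compl_adj, SimpleGraph.compl_adj, sup_edge_adj_iff h.ne]
    have e₁ : p i = x ↔ i = 0 :=
      ⟨fun e => hp.injOn (by omega) (by omega) (e.trans hx.symm), fun e => e ▸ hx⟩
    have e₂ : p j = y ↔ j = b :=
      ⟨fun e => hp.injOn (by omega) (by omega) (e.trans hy.symm), fun e => e ▸ hy⟩
    have e₃ : p j ≠ x := fun e => by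
      have := hp.injOn hj (by omega) (e.trans hx.symm)
      omega
    rw [e₁, e₂]
    have : i = 0 → j = b → ¬ G.Adj (p i) (p j) := by
      rintro rfl rfl
      rw [hx, hy]
      exact h.not_adj
    have := hcyc.1
    tauto
  have hb0 : b ≠ 0 := by rintro rfl; exact h.ne (hx ▸ hy)
  have hnot : ¬ (G ⊔ SimpleGraph.edge x y)ᶜ.Adj (p 0) (p b) := by
    rw [SimpleGraph.compl_adj, sup_edge_adj_iff h.ne]
    tauto
  rw [(hp 0 b (by omega) hb).2] at hnot
  -- the new edge cuts the cycle of the complement into two shorter induced cycles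
  have hle : b ≤ 3 := by
    by_contra! hb4
    refine hG.not_isInducedCycle_compl (p := p) (n := b + 1) (by omega) fun i j hij hj => ?_
    exact ⟨(hp i j hij (by omega)).1, (hadj i j hij (by omega)).trans (by omega)⟩
  have hge : n ≤ b + 3 := by
    by_contra! hb4
    refine hG.not_isInducedCycle_compl (p := fun i => if i = 0 then p 0 else p (b + i - 1))
      (n := n - b + 1) (by omega) fun i j hij hj => ?_
    have hj0 : j ≠ 0 := by omega
    by_cases hi : i = 0
    · simp only [hi, hj0, if_true, if_false, true_and]
      exact ⟨(hp 0 (b + j - 1) (by omega) (by omega)).1,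
        (hadj 0 (b + j - 1) (by omega) (by omega)).trans (by omega)⟩
    · simp only [hi, hj0, if_false, false_and, or_false]
      exact ⟨(hp (b + i - 1) (b + j - 1) (by omega) (by omega)).1,
        (hadj (b + i - 1) (b + j - 1) (by omega) (by omega)).trans (by omega)⟩
  have hG' (i j : ℕ) (hi : i < n) (hj : j < n) : G.Adj (p i) (p j) ↔ i ≠ j ∧
      ¬ ((min i j + 1 = max i j ∨ min i j = 0 ∧ max i j + 1 = n) ∨
        min i j = 0 ∧ max i j = b) := by
    rcases lt_trichotomy i j with h' | rfl | h'
    · have := hadj i j h' hj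
      have h2 := (hp i j h' hj).1
      rw [SimpleGraph.compl_adj] at this
      rw [and_iff_right h2, eq_comm (a := j) (b := i + 1)] at this
      rw [min_eq_left h'.le, max_eq_right h'.le, and_iff_right h'.ne, ← this, not_not]
    · simp
    · have := hadj j i h' hi
      have h2 := (hp j i h' hi).1
      rw [SimpleGraph.compl_adj, and_iff_right h2, SimpleGraph.adj_comm,
        eq_comm (a := i) (b := j + 1)] at this
      rw [min_eq_right h'.le, max_eq_left h'.le, and_iff_right h'.ne', ← this, not_not]
  -- a sequence of positions on the cycle that spells a long induced path of `G` is absurd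
  have key (f : ℕ → ℕ) (m : ℕ) (hm : 3 ≤ m) (hf : ∀ i ≤ m, f i < n) (hf0 : f 0 = 0) (hfm : f m = b)
      (hpath : ∀ i j, i < j → j ≤ m → f i ≠ f j ∧
        (¬ ((min (f i) (f j) + 1 = max (f i) (f j) ∨
            min (f i) (f j) = 0 ∧ max (f i) (f j) + 1 = n) ∨
          min (f i) (f j) = 0 ∧ max (f i) (f j) = b) ↔ j = i + 1)) : False := by
    have := h.length_le_two (fun i => p (f i)) m (fun i j hij hj => ?_)
      (fun _ _ => Set.mem_univ _) (by simpa [hf0]) (by simpa [hfm])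
    · omega
    · obtain ⟨h1, h2⟩ := hpath i j hij hj
      have hi' := hf i (by omega)
      have hj' := hf j hj
      refine ⟨fun e => h1 (hp.injOn hi' hj' e), ?_⟩
      rw [hG' _ _ hi' hj', and_iff_right h1, h2]
  obtain ⟨rfl, rfl⟩ | ⟨rfl, rfl⟩ | ⟨rfl, rfl⟩ :
      (n = 5 ∧ b = 2) ∨ (n = 5 ∧ b = 3) ∨ (n = 6 ∧ b = 3) := by omega
  · refine key (fun i => [0, 3, 1, 4, 2].getD i 0) 4 (by omega) ?_ rfl rfl ?_
    · intro i hi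
      interval_cases i <;> decide
    · intro i j hij hj
      interval_cases j <;> interval_cases i <;> decide
  · refine key (fun i => [0, 2, 4, 1, 3].getD i 0) 4 (by omega) ?_ rfl rfl ?_
    · intro i hi
      interval_cases i <;> decide
    · intro i j hij hj
      interval_cases j <;> interval_cases i <;> decide
  · refine key (fun i => [0, 4, 1, 3].getD i 0) 3 (by omega) ?_ rfl rfl ?_
    · intro i hi
      interval_cases i <;> decide
    · intro i j hij hj
      interval_cases j <;> interval_cases i <;> decide

/-- Joining the vertices of a two-pair preserves weak chordality. -/
lemma WeaklyChordal.sup_edge {V : Type} {G : SimpleGraph V} (hG : WeaklyChordal G) {x y : V}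
    (h : IsTwoPairOn G Set.univ x y) : WeaklyChordal (G ⊔ SimpleGraph.edge x y) := by
  have hcongr (p : ℕ → V) (n : ℕ) (hno : ¬ ((∃ a < n, p a = x) ∧ ∃ b < n, p b = y))
      (i : ℕ) (hi : i < n) (j : ℕ) (hj : j < n) :
      G.Adj (p i) (p j) ↔ (G ⊔ SimpleGraph.edge x y).Adj (p i) (p j) := by
    rw [sup_edge_adj_iff h.ne]
    refine ⟨Or.inl, ?_⟩
    rintro (e | e | e)
    exacts [e, absurd ⟨⟨i, hi, e.1⟩, j, hj, e.2⟩ hno, absurd ⟨⟨j, hj, e.2⟩, i, hi, e.1⟩ hno]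
  constructor <;> intro n hn hcyc <;>
    obtain ⟨p, hp⟩ := (hasInducedCycleLen_iff (by omega)).1 hcyc <;>
    by_cases hno : (∃ a < n, p a = x) ∧ ∃ b < n, p b = y
  · obtain ⟨⟨a, ha, hax⟩, b, hb, hby⟩ := hno
    exact h.not_isInducedCycle_sup_edge (by omega) hp ha hb hax hby
  · exact hG.not_isInducedCycle hn (hp.congr (hcongr p n hno))
  · obtain ⟨⟨a, ha, hax⟩, b, hb, hby⟩ := hno
    have hrot := hp.rotate ha
    have h0 : (fun i => if i + a < n then p (i + a) else p (i + a - n)) 0 = x := by simpa [ha]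
    by_cases hab : a ≤ b
    · refine h.not_isInducedCycle_compl_sup_edge hG hn hrot (b := b - a) (by omega) h0 ?_
      simpa [hab, hb] using hby
    · refine h.not_isInducedCycle_compl_sup_edge hG hn hrot (b := b + n - a) (by omega) h0 ?_
      have e₁ : ¬ b + n - a + a < n := by omega
      have e₂ : b + n - a + a - n = b := by omega
      simpa only [e₁, e₂, if_false] using hby
  · refine hG.not_isInducedCycle_compl hn (hp.congr fun i hi j hj => ?_)
    rw [SimpleGraph.compl_adj, SimpleGraph.compl_adj, hcongr p n hno i hi j hj]

lemma chordal_top {V : Type} : Chordal (⊤ : SimpleGraph V) := by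
  intro n hn hcyc
  obtain ⟨p, hp⟩ := (hasInducedCycleLen_iff (by omega)).1 hcyc
  have h02 := hp 0 2 (by omega) (by omega)
  have := h02.2.1 h02.1
  omega

lemma addEdges_zero {V : Type} (G : SimpleGraph V) {k : ℕ} (e : Fin k → Sym2 V) :
    addEdges G e 0 = G := by
  simp [addEdges]

lemma addEdges_cons {V : Type} (G : SimpleGraph V) (x y : V) {k : ℕ} (e : Fin k → Sym2 V)
    (m : ℕ) :
    addEdges G (Fin.cons s(x, y) e : Fin (k + 1) → Sym2 V) (m + 1) =
      addEdges (G ⊔ SimpleGraph.edge x y) e m := by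
  have himage : (Fin.cons s(x, y) e : Fin (k + 1) → Sym2 V) '' {j | (j : ℕ) < m + 1} =
      insert s(x, y) (e '' {j | (j : ℕ) < m}) := by
    ext z
    simp [Fin.exists_fin_succ, eq_comm]
  ext v w
  rw [addEdges, addEdges, himage]
  simp only [SimpleGraph.fromEdgeSet_adj, Set.mem_union, Set.mem_insert_iff,
    SimpleGraph.mem_edgeSet, SimpleGraph.sup_adj, SimpleGraph.edge, Set.mem_singleton_iff]
  tauto

/-- For a weakly chordal graph `G` there is a sequence of new edges `e_1, …, e_k`
such that each intermediate graph `G_i` (for `i = 1, …, k-1`) is weakly chordal,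
the edge `e_i` lies on no induced 4-cycle of `G_i`, and the final graph `G_k`
is chordal. -/
theorem weaklyChordal_completion {V : Type} [Fintype V] (G : SimpleGraph V)
    (hG : WeaklyChordal G) :
    ∃ (k : ℕ) (e : Fin k → Sym2 V), Function.Injective e ∧
      (∀ i : Fin k, ¬ (e i).IsDiag ∧ e i ∉ G.edgeSet) ∧
      (∀ m : ℕ, 1 ≤ m → m < k → WeaklyChordal (addEdges G e m)) ∧
      (∀ i : Fin k, ¬ ∃ s : Set V, (∀ v ∈ e i, v ∈ s) ∧
        Nonempty ((addEdges G e ((i : ℕ) + 1)).induce s ≃g SimpleGraph.cycleGraph 4)) ∧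
      Chordal (addEdges G e k) := by
  induction hn : Gᶜ.edgeSet.ncard using Nat.strong_induction_on generalizing G with
  | _ n ih =>
  by_cases hcl : G.IsClique Set.univ
  · obtain rfl : G = ⊤ := SimpleGraph.isClique_univ.1 hcl
    refine ⟨0, Fin.elim0, fun i => i.elim0, fun i => i.elim0, fun m h1 h2 => by omega,
      fun i => i.elim0, ?_⟩
    rw [addEdges_zero]
    exact chordal_top
  obtain ⟨x, -, y, -, hxy⟩ := hG.exists_isTwoPairOn Set.univ hcl
  have hlt : (G ⊔ SimpleGraph.edge x y)ᶜ.edgeSet.ncard < n := by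
    rw [← hn]
    refine Set.ncard_lt_ncard (SimpleGraph.edgeSet_ssubset_edgeSet.2 ?_) (Set.toFinite _)
    refine compl_lt_compl_iff_lt.2 (lt_of_le_of_ne le_sup_left fun he => hxy.not_adj ?_)
    rw [he, sup_edge_adj_iff hxy.ne]
    tauto
  have hG' := hG.sup_edge hxy
  obtain ⟨k, e, hinj, hnew, hweak, hfour, hchordal⟩ := ih _ hlt _ hG' rfl
  have hmem : s(x, y) ∈ (G ⊔ SimpleGraph.edge x y).edgeSet :=
    (sup_edge_adj_iff hxy.ne _ _).2 (by tauto)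
  refine ⟨k + 1, Fin.cons s(x, y) e, ?_, ?_, ?_, ?_, ?_⟩
  · refine Fin.cons_injective_iff.2 ⟨?_, hinj⟩
    rintro ⟨i, hi⟩
    exact (hnew i).2 (hi ▸ hmem)
  · refine Fin.cases ⟨by simpa using hxy.ne, by simpa using hxy.not_adj⟩ fun i => ?_
    exact ⟨(hnew i).1, fun h => (hnew i).2 (SimpleGraph.edgeSet_mono le_sup_left h)⟩
  · intro m h1 hm
    obtain ⟨m, rfl⟩ : ∃ l, m = l + 1 := ⟨m - 1, by omega⟩
    rw [addEdges_cons]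
    rcases Nat.eq_zero_or_pos m with rfl | hm0
    · rwa [addEdges_zero]
    · exact hweak m hm0 (by omega)
  · refine Fin.cases ?_ fun i => ?_
    · rw [addEdges_cons, Fin.val_zero, addEdges_zero]
      rintro ⟨s, hs, hiso⟩
      obtain ⟨p, hp, hps⟩ := exists_isInducedCycle_of_iso (by omega) hiso
      obtain ⟨a, ha, hax⟩ := hps x (hs x (by simp))
      obtain ⟨b, hb, hby⟩ := hps y (hs y (by simp))
      exact hxy.not_isInducedCycle_sup_edge le_rfl hp ha hb hax hby
    · rw [addEdges_cons]
      exact hfour i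
  · rwa [addEdges_cons]
end

section
/- Let ℓ ≥ 4 and read indices in {1,…,ℓ} cyclically modulo ℓ. For every i ∈ {1,…,ℓ}, the following identity of derivations of S holds: (x_{i−1} − x_i)φ_i − (x_{i+1} − x_{i+2})φ_{i+1} + Σ_{j=0}^{ℓ−3} (−1)^{ℓ−2−j} e_{ℓ−2−j}(x_1,…,x̂_i,x̂_{i+1},…,x_ℓ) · θ_j = −θ_{ℓ−2}. -/
open MvPolynomial CategoryTheory

/-- The derivation `θ_i = Σ_j x_j^i ∂/∂x_j`. -/
noncomputable def θder (ℓ : ℕ) (i : ℕ) : Derivation ℚ (Spoly ℓ) (Spoly ℓ) :=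
  MvPolynomial.mkDerivation ℚ (fun j : Fin ℓ => X j ^ i)

/-- The derivation `φ_i = (∏_{j ∉ {i-1, i, i+1}} (x_i - x_j)) ∂/∂x_i`,
indices read cyclically. -/
noncomputable def φder (ℓ : ℕ) [NeZero ℓ] (i : Fin ℓ) : Derivation ℚ (Spoly ℓ) (Spoly ℓ) :=
  MvPolynomial.mkDerivation ℚ (fun j : Fin ℓ =>
    if j = i then ∏ t ∈ Finset.univ \ {i - 1, i, i + 1}, (X i - X t) else 0)

/-- The `n`-th elementary symmetric polynomial in the variables `x_v`, `v ∈ s`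
(equal to `0` when `n > #s`). -/
noncomputable def esub (ℓ : ℕ) (s : Finset (Fin ℓ)) (n : ℕ) : Spoly ℓ :=
  ∑ t ∈ s.powersetCard n, ∏ v ∈ t, X v

theorem prod_sub_eq_sum_esub (ℓ : ℕ) (s : Finset (Fin ℓ)) (y : Spoly ℓ) :
    ∏ v ∈ s, (y - X v) =
      ∑ j ∈ Finset.range (s.card + 1), (-1) ^ (s.card - j) * esub ℓ s (s.card - j) * y ^ j := by
  have h : ∏ v ∈ s, (y - X v) = ∏ v ∈ s, (-X v + y) :=
    Finset.prod_congr rfl fun v _ => by ring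
  rw [h, Finset.prod_add, Finset.sum_powerset, ← Finset.sum_range_reflect]
  refine Finset.sum_congr rfl fun j hj => ?_
  have hj' : j ≤ s.card := Nat.lt_succ_iff.mp (Finset.mem_range.mp hj)
  rw [Nat.add_sub_cancel, esub, Finset.mul_sum, Finset.sum_mul]
  refine Finset.sum_congr rfl fun t ht => ?_
  obtain ⟨hts, htc⟩ := Finset.mem_powersetCard.mp ht
  rw [Finset.prod_neg, Finset.prod_const, Finset.card_sdiff_of_subset hts, htc,
    Nat.sub_sub_self hj']

/-- The identity
`(x_{i-1} - x_i) φ_i - (x_{i+1} - x_{i+2}) φ_{i+1}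
  + Σ_{j=0}^{ℓ-3} (-1)^{ℓ-2-j} e_{ℓ-2-j}(x_1, …, x̂_i, x̂_{i+1}, …, x_ℓ) θ_j = -θ_{ℓ-2}`,
indices read cyclically modulo `ℓ`. -/
theorem psi_theta_identity (ℓ : ℕ) [NeZero ℓ] (hℓ : 4 ≤ ℓ) (i : Fin ℓ) :
    (X (i - 1) - X i : Spoly ℓ) • φder ℓ i
        - (X (i + 1) - X (i + 2) : Spoly ℓ) • φder ℓ (i + 1) +
      ∑ j ∈ Finset.range (ℓ - 2),
        ((-1 : Spoly ℓ) ^ (ℓ - 2 - j) * esub ℓ (Finset.univ \ {i, i + 1}) (ℓ - 2 - j)) •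
          θder ℓ j
      = - θder ℓ (ℓ - 2) := by
  have h₁ : (1 : Fin ℓ) ≠ 0 := by
    simp [Fin.ext_iff, Nat.mod_eq_of_lt (show 1 < ℓ by lia)]
  have h₂ : (2 : Fin ℓ) ≠ 0 := by
    simp [Fin.ext_iff, Nat.mod_eq_of_lt (show 2 < ℓ by lia)]
  have h₁₁ : (1 : Fin ℓ) + 1 = 2 := by
    simp [Fin.ext_iff, Fin.val_add]
  have hne : i ≠ i + 1 := by simpa using h₁
  have hcard : (Finset.univ \ {i, i + 1} : Finset (Fin ℓ)).card = ℓ - 2 := by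
    rw [Finset.card_sdiff_of_subset (Finset.subset_univ _), Finset.card_pair hne,
      Finset.card_univ, Fintype.card_fin]
  refine MvPolynomial.derivation_ext fun m => ?_
  have key := prod_sub_eq_sum_esub ℓ (Finset.univ \ {i, i + 1}) (X m)
  rw [hcard, Finset.sum_range_succ, Nat.sub_self] at key
  have he : esub ℓ (Finset.univ \ {i, i + 1}) 0 = 1 := by simp [esub]
  rw [he, pow_zero, one_mul, one_mul] at key
  have hsum : (∑ j ∈ Finset.range (ℓ - 2),
      ((-1 : Spoly ℓ) ^ (ℓ - 2 - j) * esub ℓ (Finset.univ \ {i, i + 1}) (ℓ - 2 - j)) •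
        θder ℓ j) (X m) = ∏ v ∈ Finset.univ \ {i, i + 1}, (X m - X v) - X m ^ (ℓ - 2) := by
    rw [key, add_sub_cancel_right, ← Derivation.coeFnAddMonoidHom_apply, map_sum,
      Finset.sum_apply]
    refine Finset.sum_congr rfl fun j _ => ?_
    simp [Derivation.coeFnAddMonoidHom, θder, mkDerivation_X]
  rw [Derivation.add_apply, hsum, Derivation.sub_apply, Derivation.smul_apply,
    Derivation.smul_apply, Derivation.neg_apply]
  simp only [φder, θder, mkDerivation_X, smul_eq_mul]
  by_cases hi : m = i
  · subst hi
    have hs : (Finset.univ \ {m, m + 1} : Finset (Fin ℓ)) =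
        insert (m - 1) (Finset.univ \ {m - 1, m, m + 1}) := by
      ext t
      have a : m - 1 ≠ m := by simpa using h₁
      have b : m - 1 ≠ m + 1 := by
        rw [Ne, sub_eq_iff_eq_add, add_assoc, h₁₁]
        simpa using h₂
      simp only [Finset.mem_sdiff, Finset.mem_univ, Finset.mem_insert, Finset.mem_singleton]
      grind
    rw [hs, Finset.prod_insert (by simp), if_pos rfl, if_neg hne]
    ring
  by_cases hi' : m = i + 1
  · subst hi'
    have hs : (Finset.univ \ {i, i + 1} : Finset (Fin ℓ)) =
        insert (i + 2) (Finset.univ \ {i, i + 1, i + 2}) := by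
      ext t
      have a : i + 2 ≠ i := by simpa using h₂
      have b : i + 2 ≠ i + 1 := by
        rw [← h₁₁, ← add_assoc]
        simpa using h₁
      simp only [Finset.mem_sdiff, Finset.mem_univ, Finset.mem_insert, Finset.mem_singleton]
      grind
    rw [hs, Finset.prod_insert (by simp), if_neg hi, if_pos rfl, add_sub_cancel_right,
      add_assoc i 1 1, h₁₁]
    ring
  · rw [if_neg hi, if_neg hi', Finset.prod_eq_zero (i := m) (by simp [hi, hi']) (sub_self _)]
    ring
end

section
/- For every ℓ ≥ 3, the projective dimension of the S-module D(A(C_ℓ)) equals ℓ − 3, where C_ℓ is the cycle graph on ℓ vertices with edges {1,2},{2,3},…,{ℓ−1,ℓ},{ℓ,1}. -/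
open MvPolynomial CategoryTheory

section

open Abelian

universe v u
variable {C : Type u} [Category.{v} C] [Abelian C]

lemma hasProjectiveDimensionLE_of_resolution {M : C} (P : ProjectiveResolution M) (n : ℕ)
    (hP : ∀ i, n < i → Limits.IsZero (P.complex.X i)) : HasProjectiveDimensionLE M n := by
  let := HasExt.standard C
  refine HasProjectiveDimensionLT.mk fun i hi Y e ↦ ?_
  obtain ⟨f, hf, rfl⟩ := P.extMk_surjective e (i + 1) rfl
  obtain rfl : f = 0 := (hP i hi).eq_of_src _ _
  simp

namespace CategoryTheory.ProjectiveResolution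

/-- The augmentation `P₀ ⟶ Z` of a projective resolution `P` of `Z`. -/
noncomputable def augmentation {Z : C} (P : ProjectiveResolution Z) : P.complex.X 0 ⟶ Z :=
  P.π.f 0

lemma d_comp_augmentation {Z : C} (P : ProjectiveResolution Z) :
    P.complex.d 1 0 ≫ P.augmentation = 0 :=
  P.complex_d_comp_π_f_zero

lemma exact_augmentation {Z : C} (P : ProjectiveResolution Z) :
    (ShortComplex.mk _ _ P.d_comp_augmentation).Exact :=
  P.exact₀

instance {Z : C} (P : ProjectiveResolution Z) : Epi P.augmentation :=
  inferInstanceAs (Epi (P.π.f 0))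

/-- Splicing a projective resolution of the kernel of an epimorphism from a projective object
gives a projective resolution of the target. -/
noncomputable def splice {S : ShortComplex C} (hS : S.ShortExact)
    [Projective S.X₂] (P : ProjectiveResolution S.X₁) : ProjectiveResolution S.X₃ where
  complex := P.complex.augment (P.augmentation ≫ S.f) (by
    rw [← Category.assoc, d_comp_augmentation, Limits.zero_comp])
  projective n := by
    cases n
    · assumption
    · exact P.projective _
  π := (ChainComplex.toSingle₀Equiv _ _).symm ⟨S.g, by
    have w : (P.augmentation ≫ S.f) ≫ S.g = 0 := by
      rw [Category.assoc, S.zero, Limits.comp_zero]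
    exact w⟩
  quasiIso := ⟨fun n => by
    have := hS.mono_f
    match n with
    | 0 =>
      rw [ChainComplex.quasiIsoAt₀_iff, ShortComplex.quasiIso_iff_of_zeros']
      · have w : (P.augmentation ≫ S.f) ≫ S.g = 0 := by
          rw [Category.assoc, S.zero, Limits.comp_zero]
        let α : ShortComplex.mk (P.augmentation ≫ S.f) S.g w ⟶ S :=
          { τ₁ := P.augmentation, τ₂ := 𝟙 _, τ₃ := 𝟙 _ }
        have : Epi α.τ₁ := inferInstanceAs (Epi P.augmentation)
        have : IsIso α.τ₂ := inferInstanceAs (IsIso (𝟙 _))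
        have : Mono α.τ₃ := inferInstanceAs (Mono (𝟙 _))
        have ex := (ShortComplex.exact_iff_of_epi_of_isIso_of_mono α).2 hS.exact
        refine (ShortComplex.exact_and_epi_g_iff_of_iso ?_).2 ⟨ex, hS.epi_g⟩
        refine ShortComplex.isoMk (Iso.refl _) (Iso.refl _) (Iso.refl _) ?_ ?_
        · exact (Category.id_comp _).trans (Category.comp_id _).symm
        · refine (Category.id_comp _).trans (Eq.trans ?_ (Category.comp_id _).symm)
          exact (ChainComplex.toSingle₀Equiv_symm_apply_f_zero
            (C := P.complex.augment (P.augmentation ≫ S.f) _) S.g w).symm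
      all_goals rfl
    | 1 =>
      rw [quasiIsoAt_iff_exactAt' _ _ (ChainComplex.exactAt_succ_single_obj _ _),
        HomologicalComplex.exactAt_iff' _ 2 1 0 (by simp) (by simp)]
      let α : ShortComplex.mk _ _ P.d_comp_augmentation ⟶
          ShortComplex.mk (P.complex.d 1 0) (P.augmentation ≫ S.f)
            (by rw [← Category.assoc, d_comp_augmentation, Limits.zero_comp]) :=
        { τ₁ := 𝟙 _, τ₂ := 𝟙 _, τ₃ := S.f }
      have : Epi α.τ₁ := inferInstanceAs (Epi (𝟙 _))
      have : IsIso α.τ₂ := inferInstanceAs (IsIso (𝟙 _))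
      have : Mono α.τ₃ := inferInstanceAs (Mono S.f)
      exact (ShortComplex.exact_iff_of_epi_of_isIso_of_mono α).1 P.exact_augmentation
    | n + 2 =>
      rw [quasiIsoAt_iff_exactAt' _ _ (ChainComplex.exactAt_succ_single_obj _ _),
        HomologicalComplex.exactAt_iff' _ (n + 3) (n + 2) (n + 1) (by simp) (by simp)]
      exact P.exact_succ n⟩

end CategoryTheory.ProjectiveResolution

variable [EnoughProjectives C]

lemma exists_resolution_of_hasProjectiveDimensionLE (n : ℕ) (M : C)
    [HasProjectiveDimensionLE M n] :
    ∃ P : ProjectiveResolution M, ∀ i, n < i → Limits.IsZero (P.complex.X i) := by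
  induction n generalizing M with
  | zero =>
    have : Projective M := (projective_iff_hasProjectiveDimensionLE_zero M).2 ‹_›
    refine ⟨.self M, fun i hi ↦ ?_⟩
    obtain ⟨i, rfl⟩ := Nat.exists_eq_succ_of_ne_zero hi.ne'
    exact HomologicalComplex.isZero_single_obj_X _ _ _ _ (by simp)
  | succ n ih =>
    let S : ShortComplex C := ShortComplex.mk (Limits.kernel.ι (Projective.π M)) (Projective.π M)
      (Limits.kernel.condition _)
    have hS : S.ShortExact :=
      { exact := ShortComplex.exact_of_f_is_kernel _ (Limits.kernelIsKernel _)
        mono_f := inferInstanceAs (Mono (Limits.kernel.ι (Projective.π M)))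
        epi_g := inferInstanceAs (Epi (Projective.π M)) }
    have : Projective S.X₂ := Projective.projective_over M
    have := (hS.hasProjectiveDimensionLT_X₃_iff n this).1 ‹_›
    obtain ⟨P, hP⟩ := ih S.X₁
    refine ⟨P.splice hS, fun i hi ↦ ?_⟩
    obtain ⟨i, rfl⟩ := Nat.exists_eq_succ_of_ne_zero (Nat.ne_zero_of_lt hi)
    exact hP i (by omega)
end


lemma pdLE_iff {R : Type} [CommRing R] (M : ModuleCat.{0} R) (n : ℕ) :
    pdLE M n ↔ HasProjectiveDimensionLE M n :=
  ⟨fun ⟨P, hP⟩ ↦ hasProjectiveDimensionLE_of_resolution P n hP,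
    fun _ ↦ exists_resolution_of_hasProjectiveDimensionLE n M⟩

lemma pd_eq {R : Type} [CommRing R] (M : ModuleCat.{0} R) (n : ℕ)
    (h : ∀ k, HasProjectiveDimensionLE M k ↔ n ≤ k) : pd M = n := by
  refine le_antisymm (sInf_le ⟨n, rfl, (pdLE_iff M n).2 ((h n).2 le_rfl)⟩) (le_sInf ?_)
  rintro _ ⟨k, rfl, hk⟩
  exact_mod_cast (h k).1 ((pdLE_iff M k).1 hk)

section

open Abelian RingTheory.Sequence

universe u
variable {R : Type u} [CommRing R]
namespace ModuleCat

lemma nontrivial_ext_of_iso {M M' : ModuleCat.{u} R} (i : M ≅ M') (N : ModuleCat.{u} R) (n : ℕ)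
    [Nontrivial (Ext M N n)] : Nontrivial (Ext M' N n) := by
  obtain ⟨e, he⟩ := exists_ne (0 : Ext M N n)
  refine nontrivial_of_ne ((Ext.mk₀ i.inv).comp e (zero_add n)) 0 fun h ↦ he ?_
  have := congrArg (fun f ↦ (Ext.mk₀ i.hom).comp f (zero_add n)) h
  simpa using this

lemma mk₀_smul_id_comp {M N : ModuleCat.{u} R} (x : R) {n : ℕ} (e : Ext M N n) :
    (Ext.mk₀ (x • 𝟙 M)).comp e (zero_add n) = e.comp (Ext.mk₀ (x • 𝟙 N)) (add_zero n) := by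
  rw [Ext.mk₀_smul, Ext.smul_comp, Ext.mk₀_id_comp, Ext.mk₀_smul, Ext.comp_smul,
    Ext.comp_mk₀_id]

lemma nontrivial_ext_quotSMulTop (M N : ModuleCat.{u} R) (x : R) (reg : IsSMulRegular M x)
    (hN : x ∈ Module.annihilator R N) (n : ℕ) [hn : Nontrivial (Ext M N n)] :
    Nontrivial (Ext (ModuleCat.of R (QuotSMulTop x M)) N (n + 1)) := by
  have hS := reg.smulShortComplex_shortExact
  obtain ⟨e, he⟩ := exists_ne (0 : Ext M N n)
  by_contra! h
  obtain ⟨(e' : Ext M N n), he'⟩ := Ext.contravariant_sequence_exact₁ hS N e (add_comm 1 n)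
    (@Subsingleton.elim _ h _ _)
  apply he
  have h0 : x • 𝟙 N = 0 := by
    ext y
    exact Module.mem_annihilator.1 hN y
  have hx : (Ext.mk₀ (x • 𝟙 M)).comp e' (zero_add n) = e := he'
  rw [← hx]
  refine (mk₀_smul_id_comp x e').trans ?_
  rw [h0, Ext.mk₀_zero, Ext.comp_zero]

lemma nontrivial_ext_quotient_ofList (M N : ModuleCat.{u} R) (rs : List R)
    (reg : IsWeaklyRegular M rs) (hN : ∀ r ∈ rs, r ∈ Module.annihilator R N) (n : ℕ)
    [hn : Nontrivial (Ext M N n)] :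
    Nontrivial (Ext (ModuleCat.of R (M ⧸ Ideal.ofList rs • (⊤ : Submodule R M))) N
      (n + rs.length)) := by
  induction rs generalizing M n with
  | nil =>
    have h : Ideal.ofList ([] : List R) • (⊤ : Submodule R M) = ⊥ := by
      rw [Ideal.ofList_nil, Submodule.bot_smul]
    exact nontrivial_ext_of_iso (LinearEquiv.toModuleIso
      (Submodule.quotEquivOfEqBot _ h).symm) N n
  | cons x rs ih =>
    simp only [List.mem_cons, forall_eq_or_imp] at hN
    rw [isWeaklyRegular_cons_iff] at reg
    have := nontrivial_ext_quotSMulTop M N x reg.1 hN.1 n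
    have := ih (ModuleCat.of R (QuotSMulTop x M)) reg.2 hN.2 (n + 1)
    rw [List.length_cons, add_comm rs.length, ← add_assoc]
    exact nontrivial_ext_of_iso (LinearEquiv.toModuleIso
      (Submodule.quotOfListConsSMulTopEquivQuotSMulTopInner M x rs).symm) N _

lemma hasProjectiveDimensionLT_quotient_ofList (M : ModuleCat.{u} R) (rs : List R)
    (reg : IsWeaklyRegular M rs) (n : ℕ) [hn : HasProjectiveDimensionLT M n] :
    HasProjectiveDimensionLT (ModuleCat.of R (M ⧸ Ideal.ofList rs • (⊤ : Submodule R M)))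
      (n + rs.length) := by
  induction rs generalizing M n with
  | nil =>
    refine hasProjectiveDimensionLT_of_iso (X := M) (LinearEquiv.toModuleIso
      (Submodule.quotEquivOfEqBot _ ?_).symm) n
    rw [Ideal.ofList_nil, Submodule.bot_smul]
  | cons x rs ih =>
    rw [isWeaklyRegular_cons_iff] at reg
    have : HasProjectiveDimensionLT (ModuleCat.of R (QuotSMulTop x M)) (n + 1) :=
      reg.1.smulShortComplex_shortExact.hasProjectiveDimensionLT_X₃ n hn
        (hasProjectiveDimensionLT_of_ge M n (n + 1) (Nat.le_succ n))
    have := ih (ModuleCat.of R (QuotSMulTop x M)) reg.2 (n + 1)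
    rw [List.length_cons, add_comm rs.length, ← add_assoc]
    exact hasProjectiveDimensionLT_of_iso (LinearEquiv.toModuleIso
      (Submodule.quotOfListConsSMulTopEquivQuotSMulTopInner M x rs).symm) _

lemma hasProjectiveDimensionLT_quotient_ofList_iff (rs : List R) (reg : IsWeaklyRegular R rs)
    [hn : Nontrivial (R ⧸ (Ideal.ofList rs • ⊤ : Submodule R R))] (k : ℕ) :
    HasProjectiveDimensionLT (ModuleCat.of R (R ⧸ (Ideal.ofList rs • ⊤ : Submodule R R))) k ↔
      rs.length < k := by
  constructor
  · intro h
    by_contra! hk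
    let N := ModuleCat.of R (R ⧸ (Ideal.ofList rs • ⊤ : Submodule R R))
    have : Nontrivial (Ext (ModuleCat.of R R) N 0) := by
      have : (ModuleCat.ofHom (Submodule.mkQ _) : ModuleCat.of R R ⟶ N) ≠ 0 := fun h0 ↦ by
        obtain ⟨y, hy⟩ := exists_ne (0 : R ⧸ (Ideal.ofList rs • ⊤ : Submodule R R))
        obtain ⟨r, rfl⟩ := Submodule.mkQ_surjective _ y
        exact hy (congrArg (fun f ↦ f.hom r) h0)
      exact nontrivial_of_ne (Ext.mk₀ _) 0 (mt (Ext.mk₀_eq_zero_iff _).1 this)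
    have hN : ∀ r ∈ rs, r ∈ Module.annihilator R N := by
      intro r hr
      refine Module.mem_annihilator.2 fun y ↦ ?_
      obtain ⟨s, rfl⟩ := Submodule.mkQ_surjective _ y
      rw [← map_smul]
      exact (Submodule.Quotient.mk_eq_zero _).2
        (Submodule.smul_mem_smul (Ideal.subset_span hr) trivial)
    have := nontrivial_ext_quotient_ofList (ModuleCat.of R R) N rs reg hN 0
    exact not_subsingleton _ (HasProjectiveDimensionLT.subsingleton N k (0 + rs.length) (by omega) N)
  · intro h
    have := hasProjectiveDimensionLT_quotient_ofList (ModuleCat.of R R) rs reg 1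
    exact hasProjectiveDimensionLT_of_ge _ (1 + rs.length) k (by omega)
end ModuleCat

lemma isSMulRegular_quotient_of_retraction {R : Type*} [CommRing R] [IsDomain R] {J : Ideal R}
    (φ : R →+* R) (hJ : J ≤ RingHom.ker φ) (hφ : ∀ f, f - φ f ∈ J) {r : R} (hr : φ r ≠ 0) :
    IsSMulRegular (R ⧸ (J • ⊤ : Submodule R R)) r := by
  rw [isSMulRegular_iff_right_eq_zero_of_smul]
  intro y hy
  obtain ⟨f, rfl⟩ := Submodule.mkQ_surjective _ y
  rw [← map_smul, Submodule.mkQ_apply, Submodule.Quotient.mk_eq_zero, smul_eq_mul, smul_eq_mul,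
    Ideal.mul_top] at hy
  rw [Submodule.mkQ_apply, Submodule.Quotient.mk_eq_zero, smul_eq_mul, Ideal.mul_top]
  have h0 : φ r * φ f = 0 := by
    rw [← map_mul]
    exact hJ hy
  have := hφ f
  rwa [(mul_eq_zero.1 h0).resolve_left hr, sub_zero] at this
end

section

open RingTheory.Sequence

variable (K : Type*) [Field K] (n : ℕ)

/-- The sequence of differences of consecutive variables. -/
noncomputable def consecutiveDifferences : List (MvPolynomial (Fin (n + 1)) K) :=
  List.ofFn fun k : Fin n ↦ X k.castSucc - X k.succ

@[simp]
lemma length_consecutiveDifferences : (consecutiveDifferences K n).length = n :=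
  List.length_ofFn

lemma mem_take_consecutiveDifferences {i : ℕ} {p : MvPolynomial (Fin (n + 1)) K} :
    p ∈ (consecutiveDifferences K n).take i ↔
      ∃ k : Fin n, (k : ℕ) < i ∧ X k.castSucc - X k.succ = p := by
  simp only [List.mem_take_iff_getElem, consecutiveDifferences, List.length_ofFn,
    List.getElem_ofFn]
  constructor
  · rintro ⟨j, hj, rfl⟩
    exact ⟨⟨j, by omega⟩, by simp; omega, rfl⟩
  · rintro ⟨k, hk, rfl⟩
    exact ⟨k, by omega, rfl⟩

lemma isWeaklyRegular_consecutiveDifferences :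
    IsWeaklyRegular (MvPolynomial (Fin (n + 1)) K) (consecutiveDifferences K n) := by
  refine ⟨fun i hi ↦ ?_⟩
  have hin : i < n := by simpa using hi
  set J := Ideal.ofList ((consecutiveDifferences K n).take i)
  let k : Fin n := ⟨i, hin⟩
  let φ : MvPolynomial (Fin (n + 1)) K →ₐ[K] MvPolynomial (Fin (n + 1)) K :=
    aeval fun j ↦ if j ≤ k.castSucc then X k.castSucc else X j
  have hφX (j) : φ (X j) = if j ≤ k.castSucc then X k.castSucc else X j := aeval_X _ _
  have hgen (j : Fin n) (hj : j < k) : X j.castSucc - X j.succ ∈ J :=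
    Ideal.subset_span ((mem_take_consecutiveDifferences K n).2 ⟨j, hj, rfl⟩)
  refine isSMulRegular_quotient_of_retraction φ.toRingHom ?_ ?_ ?_
  · refine Ideal.span_le.2 fun p hp ↦ ?_
    obtain ⟨j, hj, rfl⟩ := (mem_take_consecutiveDifferences K n).1 hp
    have h1 : j.castSucc ≤ k.castSucc := Fin.le_def.2 hj.le
    have h2 : j.succ ≤ k.castSucc := Fin.le_def.2 hj
    change φ _ = 0
    rw [map_sub, hφX, hφX, if_pos h1, if_pos h2, sub_self]
  · have hcollapse (j : Fin (n + 1)) (hj : j ≤ k.castSucc) : X j - X k.castSucc ∈ J := by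
      induction j using Fin.reverseInduction with
      | last =>
        exact absurd hj (by simp [Fin.le_def])
      | cast j ih =>
        rcases hj.eq_or_lt with h | h
        · rw [h, sub_self]
          exact J.zero_mem
        · have := J.add_mem (hgen j (by simpa using h)) (ih (by simpa [Fin.le_def] using! h))
          simpa using this
    have hcomp : (Ideal.Quotient.mkₐ K J).comp φ = Ideal.Quotient.mkₐ K J := by
      refine MvPolynomial.algHom_ext fun j ↦ ?_
      rw [AlgHom.comp_apply, hφX]
      split_ifs with h
      · exact (Ideal.Quotient.eq.2 (hcollapse j h)).symm
      · rfl
    exact fun f ↦ Ideal.Quotient.eq.1 (DFunLike.congr_fun hcomp f).symm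
  · have : (consecutiveDifferences K n)[i] = X k.castSucc - X k.succ := List.getElem_ofFn _
    rw [this]
    change φ _ ≠ 0
    rw [map_sub, hφX, hφX, if_pos le_rfl, if_neg (by simp [Fin.le_def]), sub_ne_zero]
    exact fun h ↦ (Fin.castSucc_lt_succ (i := k)).ne (X_injective h)

lemma ofList_consecutiveDifferences_ne_top :
    Ideal.ofList (consecutiveDifferences K n) ≠ ⊤ := by
  have : Ideal.ofList (consecutiveDifferences K n) ≤
      RingHom.ker (constantCoeff (σ := Fin (n + 1)) (R := K)) := by
    refine Ideal.span_le.2 fun p hp ↦ ?_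
    obtain ⟨k, rfl⟩ := (List.mem_ofFn' _ _).1 hp
    simp
  exact fun h ↦ RingHom.ker_ne_top _ (top_le_iff.1 (h ▸ this))
end

section
variable (m : ℕ)

/-- The derivation `θ` with `θ (x_0) = h` and prescribed quotients
`g i = (θ (x_i) - θ (x_{i+1})) / (x_i - x_{i+1})`, as a function of `(h, g)`. -/
noncomputable def derivationOfQuotients :
    (Spoly (m + 3) × (Fin (m + 3) → Spoly (m + 3))) →ₗ[Spoly (m + 3)]
      Derivation ℚ (Spoly (m + 3)) (Spoly (m + 3)) where
  toFun p := mkDerivation ℚ fun j ↦ p.1 - ∑ i ∈ Finset.Iio j, p.2 i * (X i - X (i + 1))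
  map_add' p q := by
    refine MvPolynomial.derivation_ext fun j ↦ ?_
    simp only [Derivation.add_apply, mkDerivation_X, Prod.fst_add, Prod.snd_add, Pi.add_apply,
      add_mul, Finset.sum_add_distrib]
    ring
  map_smul' c p := by
    refine MvPolynomial.derivation_ext fun j ↦ ?_
    simp only [Derivation.smul_apply, mkDerivation_X, Prod.smul_fst, Prod.smul_snd, Pi.smul_apply,
      smul_eq_mul, RingHom.id_apply, mul_sub, Finset.mul_sum, mul_assoc]

/-- The relation satisfied by the quotients of a derivation. -/
noncomputable def cyclicRelation :
    (Spoly (m + 3) × (Fin (m + 3) → Spoly (m + 3))) →ₗ[Spoly (m + 3)] Spoly (m + 3) :=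
  Fintype.linearCombination (Spoly (m + 3)) (fun i ↦ X i - X (i + 1)) ∘ₗ LinearMap.snd _ _ _

variable {m}

lemma derivationOfQuotients_X (p : Spoly (m + 3) × (Fin (m + 3) → Spoly (m + 3)))
    (j : Fin (m + 3)) : derivationOfQuotients m p (X j) =
      p.1 - ∑ i ∈ Finset.Iio j, p.2 i * (X i - X (i + 1)) :=
  mkDerivation_X _ _ _

lemma cyclicRelation_apply (p : Spoly (m + 3) × (Fin (m + 3) → Spoly (m + 3))) :
    cyclicRelation m p = ∑ i, p.2 i * (X i - X (i + 1)) := by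
  simp [cyclicRelation, Fintype.linearCombination_apply]

lemma derivationOfQuotients_X_zero (p : Spoly (m + 3) × (Fin (m + 3) → Spoly (m + 3))) :
    derivationOfQuotients m p (X 0) = p.1 := by
  rw [derivationOfQuotients_X, show Finset.Iio (0 : Fin (m + 3)) = ∅ from Finset.Iio_bot,
    Finset.sum_empty, sub_zero]

lemma derivationOfQuotients_X_sub {p : Spoly (m + 3) × (Fin (m + 3) → Spoly (m + 3))}
    (hp : cyclicRelation m p = 0) (j : Fin (m + 3)) :
    derivationOfQuotients m p (X j) - derivationOfQuotients m p (X (j + 1)) =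
      p.2 j * (X j - X (j + 1)) := by
  induction j using Fin.lastCases with
  | last =>
    rw [cyclicRelation_apply] at hp
    have huniv : (Finset.univ : Finset (Fin (m + 3))) =
        insert (Fin.last _) (Finset.Iio (Fin.last _)) := by
      rw [← Fin.top_eq_last, Finset.Iio_insert, Finset.Iic_top]
    rw [huniv, Finset.sum_insert (by simp)] at hp
    rw [show Fin.last (m + 2) + 1 = 0 from Fin.last_add_one _] at hp ⊢
    rw [derivationOfQuotients_X_zero, derivationOfQuotients_X]
    linear_combination -hp
  | cast j =>
    have hIio : Finset.Iio (j.castSucc + 1) = insert j.castSucc (Finset.Iio j.castSucc) := by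
      ext i
      rw [Fin.coeSucc_eq_succ]
      simp [Fin.le_def, Fin.lt_def]
    rw [derivationOfQuotients_X, derivationOfQuotients_X, hIio, Finset.sum_insert (by simp)]
    ring

lemma X_sub_X_add_one_ne_zero (i : Fin (m + 3)) : (X i - X (i + 1) : Spoly (m + 3)) ≠ 0 := by
  rw [sub_ne_zero]
  intro h
  simpa using X_injective h

lemma mem_logDer_cycleGraph_iff (θ : Derivation ℚ (Spoly (m + 3)) (Spoly (m + 3))) :
    θ ∈ logDer (m + 3) (SimpleGraph.cycleGraph (m + 3)) ↔
      ∀ i, (X i - X (i + 1)) ∣ θ (X i) - θ (X (i + 1)) := by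
  constructor
  · intro h i
    exact h i (i + 1) (SimpleGraph.cycleGraph_adj.2 (Or.inr (by simp)))
  · intro h i j hij
    rcases SimpleGraph.cycleGraph_adj.1 hij with h1 | h1
    · obtain rfl := sub_eq_iff_eq_add'.1 h1
      rw [← neg_sub, ← neg_sub (θ (X j)), neg_dvd, dvd_neg]
      exact h j
    · obtain rfl := sub_eq_iff_eq_add'.1 h1
      exact h i

lemma derivationOfQuotients_injOn {p : Spoly (m + 3) × (Fin (m + 3) → Spoly (m + 3))}
    (hp : cyclicRelation m p = 0) (h0 : derivationOfQuotients m p = 0) : p = 0 := by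
  refine Prod.ext ?_ (funext fun i ↦ ?_)
  · rw [← derivationOfQuotients_X_zero p, h0]
    rfl
  · have := derivationOfQuotients_X_sub hp i
    rw [h0, Derivation.zero_apply, Derivation.zero_apply, sub_zero, eq_comm] at this
    exact (mul_eq_zero.1 this).resolve_right (X_sub_X_add_one_ne_zero i)

lemma exists_derivationOfQuotients_eq {θ : Derivation ℚ (Spoly (m + 3)) (Spoly (m + 3))}
    (hθ : θ ∈ logDer (m + 3) (SimpleGraph.cycleGraph (m + 3))) :
    ∃ p, cyclicRelation m p = 0 ∧ derivationOfQuotients m p = θ := by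
  choose g hg using (mem_logDer_cycleGraph_iff θ).1 hθ
  have hp : cyclicRelation m (θ (X 0), g) = 0 := by
    rw [cyclicRelation_apply, Finset.sum_congr rfl fun i _ ↦ (mul_comm _ _).trans (hg i).symm,
      Finset.sum_sub_distrib, sub_eq_zero]
    exact (Equiv.sum_comp (Equiv.addRight 1) fun i ↦ θ (X i)).symm
  refine ⟨(θ (X 0), g), hp, MvPolynomial.derivation_ext fun j ↦ ?_⟩
  induction j using Fin.induction with
  | zero => exact derivationOfQuotients_X_zero _
  | succ j ih =>
    have h1 := derivationOfQuotients_X_sub hp j.castSucc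
    have h2 := hg j.castSucc
    rw [Fin.coeSucc_eq_succ] at h1 h2
    linear_combination ih - h1 + h2

lemma range_cyclicRelation :
    LinearMap.range (cyclicRelation m) = Ideal.ofList (consecutiveDifferences ℚ (m + 2)) := by
  have hmem (k : Fin (m + 2)) : (X k.castSucc - X k.succ : Spoly (m + 3)) ∈
      Ideal.ofList (consecutiveDifferences ℚ (m + 2)) :=
    Ideal.subset_span ((List.mem_ofFn' _ _).2 ⟨k, rfl⟩)
  have hX (j : Fin (m + 3)) : (X 0 - X j : Spoly (m + 3)) ∈
      Ideal.ofList (consecutiveDifferences ℚ (m + 2)) := by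
    induction j using Fin.induction with
    | zero => simp
    | succ j ih => simpa using Ideal.add_mem _ ih (hmem j)
  refine le_antisymm ?_ (Ideal.span_le.2 ?_)
  · rintro _ ⟨p, rfl⟩
    rw [cyclicRelation_apply]
    refine Ideal.sum_mem _ fun i _ ↦ Ideal.mul_mem_left _ _ ?_
    simpa using Ideal.sub_mem _ (hX (i + 1)) (hX i)
  · intro p hp
    obtain ⟨k, rfl⟩ := (List.mem_ofFn' _ _).1 hp
    refine ⟨(0, Pi.single k.castSucc 1), ?_⟩
    rw [cyclicRelation_apply, Finset.sum_eq_single k.castSucc]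
    · simp
    · intro b _ hb
      simp [hb]
    · simp

/-- The relation on quotients, as a surjection onto the ideal generated by the differences. -/
noncomputable def cyclicRelationToIdeal (m : ℕ) :
    (Spoly (m + 3) × (Fin (m + 3) → Spoly (m + 3))) →ₗ[Spoly (m + 3)]
      LinearMap.ker (Submodule.mkQ
        (Ideal.ofList (consecutiveDifferences ℚ (m + 2)) • ⊤ :
          Submodule (Spoly (m + 3)) (Spoly (m + 3)))) :=
  (cyclicRelation m).codRestrict _ fun p ↦ by
    rw [Submodule.ker_mkQ, smul_eq_mul, Ideal.mul_top, ← range_cyclicRelation]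
    exact ⟨p, rfl⟩

lemma cyclicRelationToIdeal_surjective : Function.Surjective (cyclicRelationToIdeal m) := by
  rintro ⟨x, hx⟩
  rw [Submodule.ker_mkQ, smul_eq_mul, Ideal.mul_top, ← range_cyclicRelation] at hx
  obtain ⟨p, rfl⟩ := hx
  exact ⟨p, rfl⟩

lemma mem_ker_cyclicRelationToIdeal {p : Spoly (m + 3) × (Fin (m + 3) → Spoly (m + 3))} :
    p ∈ LinearMap.ker (cyclicRelationToIdeal m) ↔ cyclicRelation m p = 0 := by
  rw [cyclicRelationToIdeal, LinearMap.ker_codRestrict, LinearMap.mem_ker]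

lemma derivationOfQuotients_mem_logDer {p : Spoly (m + 3) × (Fin (m + 3) → Spoly (m + 3))}
    (hp : p ∈ LinearMap.ker (cyclicRelationToIdeal m)) :
    derivationOfQuotients m p ∈ logDer (m + 3) (SimpleGraph.cycleGraph (m + 3)) := by
  refine (mem_logDer_cycleGraph_iff _).2 fun i ↦ ?_
  rw [derivationOfQuotients_X_sub (mem_ker_cyclicRelationToIdeal.1 hp)]
  exact dvd_mul_left _ _

/-- The restriction of `derivationOfQuotients` to the syzygies of the differences. -/
noncomputable def kerCyclicRelationToLogDer (m : ℕ) :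
    LinearMap.ker (cyclicRelationToIdeal m) →ₗ[Spoly (m + 3)]
      logDer (m + 3) (SimpleGraph.cycleGraph (m + 3)) :=
  (derivationOfQuotients m).restrict fun _ ↦ derivationOfQuotients_mem_logDer

lemma kerCyclicRelationToLogDer_bijective :
    Function.Bijective (kerCyclicRelationToLogDer m) := by
  constructor
  · refine (injective_iff_map_eq_zero _).2 fun p h ↦ Subtype.ext ?_
    exact derivationOfQuotients_injOn (mem_ker_cyclicRelationToIdeal.1 p.2)
      (congrArg Subtype.val h)
  · intro θ
    obtain ⟨p, hp, h⟩ := exists_derivationOfQuotients_eq θ.2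
    exact ⟨⟨p, mem_ker_cyclicRelationToIdeal.2 hp⟩, Subtype.ext h⟩

/-- Logarithmic derivations of the cycle arrangement are the syzygies of the differences, up to
a free summand. -/
noncomputable def kerCyclicRelationEquiv (m : ℕ) :
    LinearMap.ker (cyclicRelationToIdeal m) ≃ₗ[Spoly (m + 3)]
      logDer (m + 3) (SimpleGraph.cycleGraph (m + 3)) :=
  LinearEquiv.ofBijective (kerCyclicRelationToLogDer m) kerCyclicRelationToLogDer_bijective

lemma hasProjectiveDimensionLE_logDer_cycleGraph_iff (m k : ℕ) :
    HasProjectiveDimensionLE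
      (ModuleCat.of (Spoly (m + 3)) (logDer (m + 3) (SimpleGraph.cycleGraph (m + 3)))) k ↔
      m ≤ k := by
  have hS := LinearMap.shortExact_shortComplexKer (cyclicRelationToIdeal_surjective (m := m))
  have hT := LinearMap.shortExact_shortComplexKer (Submodule.mkQ_surjective
    (Ideal.ofList (consecutiveDifferences ℚ (m + 2)) • ⊤ :
          Submodule (Spoly (m + 3)) (Spoly (m + 3))))
  let e : ModuleCat.of (Spoly (m + 3)) (LinearMap.ker (cyclicRelationToIdeal m)) ≅
      ModuleCat.of (Spoly (m + 3)) (logDer (m + 3) (SimpleGraph.cycleGraph (m + 3))) :=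
    LinearEquiv.toModuleIso (kerCyclicRelationEquiv m)
  have : Nontrivial (Spoly (m + 3) ⧸ (Ideal.ofList (consecutiveDifferences ℚ (m + 2)) • ⊤ :
      Submodule (Spoly (m + 3)) (Spoly (m + 3)))) := by
    rw [Submodule.Quotient.nontrivial_iff, smul_eq_mul, Ideal.mul_top]
    exact ofList_consecutiveDifferences_ne_top ℚ (m + 2)
  have h1 : HasProjectiveDimensionLE
      (ModuleCat.of (Spoly (m + 3)) (logDer (m + 3) (SimpleGraph.cycleGraph (m + 3)))) k ↔
      HasProjectiveDimensionLT (ModuleCat.of _ (LinearMap.ker (cyclicRelationToIdeal m)))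
        (k + 1) :=
    ⟨fun _ ↦ hasProjectiveDimensionLT_of_iso e.symm _, fun _ ↦ hasProjectiveDimensionLT_of_iso e _⟩
  have h2 := hS.hasProjectiveDimensionLT_X₃_iff k
    (ModuleCat.projective_of_free (Module.Free.chooseBasis _ _))
  have h3 := hT.hasProjectiveDimensionLT_X₃_iff (k + 1)
    (ModuleCat.projective_of_free (Module.Free.chooseBasis _ _))
  have h4 := ModuleCat.hasProjectiveDimensionLT_quotient_ofList_iff _
    (isWeaklyRegular_consecutiveDifferences ℚ (m + 2)) (k + 3)
  rw [length_consecutiveDifferences] at h4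
  refine h1.trans (h2.symm.trans (h3.symm.trans (h4.trans ?_)))
  omega
end

/-- For `ℓ ≥ 3`, the projective dimension of `D(A(C_ℓ))` equals `ℓ - 3`, where
`C_ℓ` is the cycle graph on `ℓ` vertices. -/
theorem pd_cycle_eq (ℓ : ℕ) (hℓ : 3 ≤ ℓ) :
    pd (ModuleCat.of (Spoly ℓ) (logDer ℓ (SimpleGraph.cycleGraph ℓ))) = ((ℓ - 3 : ℕ) : ℕ∞) := by
  obtain ⟨m, rfl⟩ := Nat.exists_eq_add_of_le' hℓ
  rw [Nat.add_sub_cancel]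
  exact pd_eq _ _ fun k ↦ hasProjectiveDimensionLE_logDer_cycleGraph_iff m k
end
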